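/- arXiv:0907.5541 — 3 statements merged into one kernel-verified Lean document; each statement's English description precedes it below -/
import Mathlib

section
/- Suppose U is connected, the Codazzi equations ∂_v e − ∂_u f = (e+g)(∂_v λ)/(2λ) and ∂_v f − ∂_u g = −(e+g)(∂_u λ)/(2λ) hold on U, and there is a continuous function h : U → ℝ such that ‖dH‖_A ≤ h·√q pointwise on U, where q := H² − K_e. Then either Q vanishes identically on U, or every zero z₀ of Q is isolated and there exist a positive integer k, a neighborhood V of z₀, and a continuous nonvanishing function g₀ : V → ℂ such that Q(z) = (z − z₀)^k · g₀(z) on V. -/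
/-- Partial derivative in the direction `u` (i.e. `1 ∈ ℂ`) of a real-valued map on `ℂ`. -/
noncomputable def pu (ψ : ℂ → ℝ) (z : ℂ) : ℝ := fderiv ℝ ψ z 1

/-- Partial derivative in the direction `v` (i.e. `I ∈ ℂ`) of a real-valued map on `ℂ`. -/
noncomputable def pv (ψ : ℂ → ℝ) (z : ℂ) : ℝ := fderiv ℝ ψ z Complex.I

/-- The norm `‖dψ‖_A = √(((∂_u ψ)² + (∂_v ψ)²)/(2λ))` of the differential of a
real-valued function with respect to the conformal metric `A = 2λ(du²+dv²)`. -/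
noncomputable def normdA (lam : ℂ → ℝ) (ψ : ℂ → ℝ) (z : ℂ) : ℝ :=
  Real.sqrt (((pu ψ z) ^ 2 + (pv ψ z) ^ 2) / (2 * lam z))

section helpers
open MeasureTheory Metric Set Filter Topology

noncomputable def phiK (z : ℂ) : ℝ := (‖z‖ * Real.sqrt ‖z‖)⁻¹

noncomputable def dbar (P : ℂ → ℂ) (z : ℂ) : ℂ :=
  (fderiv ℝ P z 1 + Complex.I * fderiv ℝ P z Complex.I) / 2

lemma phiK_nonneg (z : ℂ) : 0 ≤ phiK z := by unfold phiK; positivity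

lemma phiK_meas : Measurable phiK := by unfold phiK; fun_prop

lemma phiK_int : IntegrableOn phiK (ball 0 3) := by
  refine integrableOn_ball_of_norm_le_rpow (E := ℂ) (μ := volume) (C := 1) (α := 3/2) (by simp) ?_ ?_ ?_
  · rw [Complex.finrank_real_complex]; norm_num
  · refine Eventually.of_forall fun z => ?_
    rw [Real.norm_of_nonneg (phiK_nonneg z)]
    unfold phiK
    rcases eq_or_ne z 0 with rfl | hz
    · simp
    · have h : 0 < ‖z‖ := norm_pos_iff.2 hz
      rw [Real.rpow_neg h.le, one_mul]
      apply le_of_eq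
      congr 1
      rw [show (3/2:ℝ) = 1 + 1/2 by norm_num, Real.rpow_add h, Real.rpow_one, Real.sqrt_eq_rpow]
  · exact phiK_meas.aestronglyMeasurable

noncomputable def KK : ℝ := ∫ z in ball (0:ℂ) 3, phiK z

lemma KK_nonneg : 0 ≤ KK := integral_nonneg fun z => phiK_nonneg z

lemma phiK_sub_int {w : ℂ} (hw : ‖w‖ ≤ 1) : IntegrableOn (fun z => phiK (z - w)) (closedBall 0 1) := by
  have h1 : Integrable ((ball (0:ℂ) 3).indicator phiK) :=
    (integrable_indicator_iff measurableSet_ball).2 phiK_int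
  have h2 := (h1.comp_sub_right w).integrableOn (s := closedBall 0 1)
  refine h2.congr_fun (fun z hz => ?_) measurableSet_closedBall
  have : z - w ∈ ball (0:ℂ) 3 := by
    rw [mem_closedBall_zero_iff] at hz
    rw [mem_ball_zero_iff]
    linarith [norm_sub_le z w]
  simp [indicator_of_mem this]

lemma phiK_sub_le {w : ℂ} (hw : ‖w‖ ≤ 1) : ∫ z in closedBall (0:ℂ) 1, phiK (z - w) ≤ KK := by
  have h1 : Integrable ((ball (0:ℂ) 3).indicator phiK) :=
    (integrable_indicator_iff measurableSet_ball).2 phiK_int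
  have e1 : KK = ∫ z, (ball (0:ℂ) 3).indicator phiK (z - w) := by
    rw [integral_sub_right_eq_self (fun z => (ball (0:ℂ) 3).indicator phiK z) w,
      integral_indicator measurableSet_ball]; rfl
  rw [e1]
  have : ∫ z in closedBall (0:ℂ) 1, phiK (z - w) =
      ∫ z in closedBall (0:ℂ) 1, (ball (0:ℂ) 3).indicator phiK (z - w) := by
    refine setIntegral_congr_fun measurableSet_closedBall fun z hz => ?_
    have : z - w ∈ ball (0:ℂ) 3 := by
      rw [mem_closedBall_zero_iff] at hz
      rw [mem_ball_zero_iff]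
      linarith [norm_sub_le z w]
    simp [indicator_of_mem this]
  rw [this]
  exact setIntegral_le_integral (h1.comp_sub_right w)
    (Eventually.of_forall fun z => indicator_nonneg (fun z _ => phiK_nonneg z) _)

/-- Cauchy-Pompeiu at the origin. -/
lemma pompeiu0 (P : ℂ → ℂ) (hP : ContDiff ℝ 1 P) (hc : HasCompactSupport P) :
    ∫ z, dbar P z / z = -(Real.pi : ℂ) * P 0 := by
  have hd : Differentiable ℝ P := hP.differentiable (by norm_num)
  have hcf : Continuous (fderiv ℝ P) := hP.continuous_fderiv (by norm_num)
  obtain ⟨R, hR⟩ : ∃ R, ∀ z, R < ‖z‖ → fderiv ℝ P z = 0 := by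
    obtain ⟨R, hR⟩ := (hc.fderiv ℝ).isBounded.subset_closedBall (0:ℂ)
    refine ⟨R, fun z hz => ?_⟩
    by_contra h
    have := hR (subset_tsupport _ h)
    rw [mem_closedBall_zero_iff] at this
    linarith
  -- direction vector
  set E : ℝ → ℂ := fun θ => (Real.cos θ + Real.sin θ * Complex.I : ℂ) with hE
  have hEc : Continuous E := by rw [hE]; fun_prop
  have hEn : ∀ θ, ‖E θ‖ = 1 := fun θ => by
    rw [hE]; simp
  set A : ℝ × ℝ → ℂ := fun p => fderiv ℝ P (p.1 * E p.2) (E p.2) with hA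
  set B : ℝ × ℝ → ℂ := fun p => fderiv ℝ P (p.1 * E p.2) (Complex.I * E p.2) with hB
  have hAc : Continuous A := by rw [hA]; fun_prop
  have hBc : Continuous B := by rw [hB]; fun_prop
  have hvan : ∀ p : ℝ × ℝ, R < p.1 → fderiv ℝ P (p.1 * E p.2) = 0 := fun p hp => hR _ (by
    rw [norm_mul, hEn, mul_one, Complex.norm_real]; exact hp.trans_le (le_abs_self _))
  have key : ∀ F : ℝ × ℝ → ℂ, Continuous F → (∀ p : ℝ × ℝ, R < p.1 → F p = 0) →
      IntegrableOn F (Ioi (0:ℝ) ×ˢ Ioo (-Real.pi) Real.pi) := by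
    intro F hF hz
    have : IntegrableOn F (Icc (0:ℝ) R ×ˢ Icc (-Real.pi) Real.pi) :=
      hF.continuousOn.integrableOn_compact (isCompact_Icc.prod isCompact_Icc)
    refine this.of_forall_sdiff_eq_zero (measurableSet_Ioi.prod measurableSet_Ioo) ?_
    rintro ⟨r, θ⟩ ⟨⟨h1, h2⟩, h3⟩
    apply hz
    by_contra h4
    exact h3 ⟨⟨le_of_lt h1, not_lt.1 h4⟩, ⟨h2.1.le, h2.2.le⟩⟩
  have hAi := key A hAc fun p hp => by rw [hA]; simp [hvan p hp]
  have hBi := key B hBc fun p hp => by rw [hB]; simp [hvan p hp]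
  rw [← Complex.integral_comp_polarCoord_symm]
  have e1 : ∫ p in polarCoord.target, p.1 • (dbar P (Complex.polarCoord.symm p) / (Complex.polarCoord.symm p))
      = ∫ p in Ioi (0:ℝ) ×ˢ Ioo (-Real.pi) Real.pi, (1/2 : ℂ) * (A p + Complex.I * B p) := by
    refine setIntegral_congr_fun (measurableSet_Ioi.prod measurableSet_Ioo) ?_
    rintro ⟨r, θ⟩ ⟨h1, h2⟩
    have h1' : (r:ℂ) ≠ 0 := by exact_mod_cast (ne_of_gt h1)
    have hE0 : E θ ≠ 0 := by rw [← norm_ne_zero_iff, hEn]; norm_num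
    simp only [Complex.polarCoord_symm_apply, dbar, hA, hB, Complex.real_smul]
    change (r:ℂ) * ((fderiv ℝ P (r * E θ) 1 + Complex.I * fderiv ℝ P (r * E θ) Complex.I) / 2 / (r * E θ)) = _
    set L := fderiv ℝ P (r * E θ)
    have lin : ∀ x y : ℝ, L (x + y * Complex.I) = x * L 1 + y * L Complex.I := by
      intro x y
      have : (x + y * Complex.I : ℂ) = x • (1:ℂ) + y • Complex.I := by simp
      rw [this, map_add, map_smul, map_smul]; simp
    have l1 : L (E θ) = Real.cos θ * L 1 + Real.sin θ * L Complex.I := lin _ _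
    have l2 : L (Complex.I * E θ) = -Real.sin θ * L 1 + Real.cos θ * L Complex.I := by
      have := lin (-Real.sin θ) (Real.cos θ)
      rw [show Complex.I * E θ = ((-Real.sin θ : ℝ) + (Real.cos θ : ℝ) * Complex.I : ℂ) by
        rw [hE]; push_cast; linear_combination (Complex.sin θ) * Complex.I_sq]
      rw [this]; push_cast; ring
    rw [l1, l2]
    field_simp
    rw [hE]
    have hcs := Complex.cos_sq_add_sin_sq (θ:ℂ)
    push_cast
    linear_combination (- L 1 - Complex.I * L Complex.I) * hcs - (Complex.sin θ * Complex.cos θ * L Complex.I - Complex.sin θ^2 * L 1) * Complex.I_sq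
  rw [e1, integral_const_mul, integral_add hAi (hBi.const_mul _), integral_const_mul]
  have eA : ∫ p in Ioi (0:ℝ) ×ˢ Ioo (-Real.pi) Real.pi, A p = -(2 * Real.pi : ℂ) * P 0 := by
    rw [Measure.volume_eq_prod] at hAi ⊢
    rw [← setIntegral_prod_swap, setIntegral_prod _ (by
      rw [IntegrableOn, ← Measure.prod_restrict] at hAi ⊢
      exact hAi.swap)]
    have : ∀ θ : ℝ, ∫ r in Ioi (0:ℝ), A (θ, r).swap = - P 0 := by
      intro θ
      have hcd : ContDiff ℝ 1 (fun r : ℝ => P (r * E θ)) :=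
        hP.comp (Complex.ofRealCLM.contDiff.mul contDiff_const)
      obtain ⟨S, hS⟩ := hc.isBounded.subset_closedBall (0:ℂ)
      have hcs : HasCompactSupport (fun r : ℝ => P (r * E θ)) := by
        refine HasCompactSupport.intro (isCompact_Icc (a := -S) (b := S)) fun r hr => ?_
        by_contra h
        have := hS (subset_tsupport _ h)
        rw [mem_closedBall_zero_iff, norm_mul, hEn, mul_one, Complex.norm_real] at this
        exact hr (abs_le.1 this)
      have h1 := hcs.integral_Ioi_deriv_eq hcd 0
      simp only [Complex.ofReal_zero, zero_mul] at h1
      rw [← h1]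
      refine setIntegral_congr_fun measurableSet_Ioi fun r _ => ?_
      have hin : HasDerivAt (fun r : ℝ => (r:ℂ) * E θ) (E θ) r := by
        simpa using (Complex.ofRealCLM.hasDerivAt (x := r)).mul_const (E θ)
      exact ((hd _).hasFDerivAt.comp_hasDerivAt r hin).deriv.symm
    simp only [this]
    rw [setIntegral_const, Measure.real, Real.volume_Ioo, ENNReal.toReal_ofReal (by linarith [Real.pi_pos])]
    rw [Complex.real_smul]; push_cast; ring
  have eB : ∫ p in Ioi (0:ℝ) ×ˢ Ioo (-Real.pi) Real.pi, B p = 0 := by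
    rw [Measure.volume_eq_prod] at hBi ⊢
    rw [setIntegral_prod _ hBi]
    have : ∀ r ∈ Ioi (0:ℝ), ∫ θ in Ioo (-Real.pi) Real.pi, B (r, θ) = 0 := by
      intro r hr
      have hr0 : (r:ℂ) ≠ 0 := by exact_mod_cast (ne_of_gt hr)
      rw [← integral_Ioc_eq_integral_Ioo, ← intervalIntegral.integral_of_le (by linarith [Real.pi_pos])]
      have hder : ∀ θ : ℝ, HasDerivAt (fun θ : ℝ => (r:ℂ)⁻¹ * P (r * E θ)) (B (r, θ)) θ := by
        intro θ
        have hin : HasDerivAt (fun θ : ℝ => (r:ℂ) * E θ) (r * (Complex.I * E θ)) θ := by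
          have h1 : HasDerivAt (fun θ : ℝ => (Real.cos θ : ℂ)) ((-Real.sin θ : ℝ):ℂ) θ :=
            (Real.hasDerivAt_cos θ).ofReal_comp
          have h2 : HasDerivAt (fun θ : ℝ => (Real.sin θ : ℂ)) ((Real.cos θ : ℝ):ℂ) θ :=
            (Real.hasDerivAt_sin θ).ofReal_comp
          have h3 := (h1.add (h2.mul_const Complex.I)).const_mul (r:ℂ)
          convert! h3 using 1
          rw [hE]; push_cast; linear_combination (r * Complex.sin θ) * Complex.I_sq
        have h4 := ((hd _).hasFDerivAt.comp_hasDerivAt θ hin).const_mul (r:ℂ)⁻¹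
        convert! h4 using 1
        have h5 := (fderiv ℝ P (r * E θ)).map_smul r (Complex.I * E θ)
        rw [Complex.real_smul, Complex.real_smul] at h5
        rw [h5, ← mul_assoc, inv_mul_cancel₀ hr0, one_mul]
      rw [intervalIntegral.integral_eq_sub_of_hasDerivAt (fun θ _ => hder θ)
        ((hBc.comp (by fun_prop : Continuous fun θ : ℝ => (r, θ))).intervalIntegrable _ _)]
      simp [hE]
    rw [setIntegral_congr_fun measurableSet_Ioi this]; simp
  rw [eA, eB]; ring

lemma pompeiu (P : ℂ → ℂ) (hP : ContDiff ℝ 1 P) (hc : HasCompactSupport P) (w : ℂ) :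
    P w = -(Real.pi : ℂ)⁻¹ * ∫ z, dbar P z / (z - w) := by
  have h := pompeiu0 (fun z => P (w + z)) (hP.comp (contDiff_const.add contDiff_id))
    (hc.comp_homeomorph (Homeomorph.addLeft w))
  have e : ∫ z, dbar P z / (z - w) = ∫ z, dbar (fun z => P (w + z)) z / z := by
    rw [← integral_add_left_eq_self _ w]
    simp [dbar, fderiv_comp_add_left]
  rw [e, h]
  have : (Real.pi:ℂ) ≠ 0 := by exact_mod_cast Real.pi_ne_zero
  field_simp
  simp

lemma aux_real (s t : ℝ) (hs : 0 ≤ s) (ht : 0 ≤ t) :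
    s⁻¹ * (t * t)⁻¹ ≤ (s * s * s)⁻¹ + (t * t * t)⁻¹ := by
  rcases hs.eq_or_lt with rfl | hs
  · simp; positivity
  rcases ht.eq_or_lt with rfl | ht
  · simp; positivity
  have e1 : s⁻¹ * (t * t)⁻¹ = (s^2 * t) / (s^3 * t^3) := by field_simp
  have e2 : (s * s * s)⁻¹ + (t * t * t)⁻¹ = (s^3 + t^3) / (s^3 * t^3) := by field_simp; ring
  rw [e1, e2]
  gcongr
  rcases le_total s t with h | h
  · nlinarith [mul_le_mul h h hs.le ht.le, pow_pos hs 3]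
  · nlinarith [mul_le_mul_of_nonneg_left h (sq_nonneg s), pow_pos ht 3]

lemma phiK_eq (z : ℂ) : phiK z = (√‖z‖ * √‖z‖ * √‖z‖)⁻¹ := by
  rw [phiK, Real.mul_self_sqrt (norm_nonneg _)]

lemma aux1 (x y : ℂ) : (√‖x‖)⁻¹ * ‖y‖⁻¹ ≤ phiK x + phiK y := by
  have := aux_real (√‖x‖) (√‖y‖) (by positivity) (by positivity)
  rwa [← phiK_eq, ← phiK_eq, Real.mul_self_sqrt (norm_nonneg _)] at this

lemma aux2 (z w : ℂ) (hz : z ≠ 0) (hzw : z - w ≠ 0) :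
    ‖w‖ * (‖z‖⁻¹ * ‖z - w‖⁻¹) ≤ 2 * √‖w‖ * (phiK z + phiK (z - w)) := by
  have h1 := aux1 z (z - w)
  have h2 := aux1 (z - w) z
  have a0 : 0 < √‖z‖ := Real.sqrt_pos.2 (norm_pos_iff.2 hz)
  have b0 : 0 < √‖z - w‖ := Real.sqrt_pos.2 (norm_pos_iff.2 hzw)
  have hw : √‖w‖ ≤ √‖z‖ + √‖z - w‖ := by
    have : ‖w‖ ≤ ‖z‖ + ‖z - w‖ := by
      have := norm_sub_le z (z - w)
      simpa using this
    refine (Real.sqrt_le_sqrt this).trans ?_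
    rw [Real.sqrt_le_left (by positivity)]
    have := Real.sq_sqrt (norm_nonneg z)
    have := Real.sq_sqrt (norm_nonneg (z - w))
    nlinarith [mul_pos a0 b0]
  have e : ‖w‖ * (‖z‖⁻¹ * ‖z - w‖⁻¹) = √‖w‖ * (√‖w‖ * (‖z‖⁻¹ * ‖z - w‖⁻¹)) := by
    rw [← mul_assoc (√‖w‖), Real.mul_self_sqrt (norm_nonneg _)]
  have e2 : (√‖z‖ + √‖z - w‖) * (‖z‖⁻¹ * ‖z - w‖⁻¹) =
      (√‖z‖)⁻¹ * ‖z - w‖⁻¹ + (√‖z - w‖)⁻¹ * ‖z‖⁻¹ := by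
    have ha : √‖z‖ * ‖z‖⁻¹ = (√‖z‖)⁻¹ := by
      nth_rewrite 2 [← Real.mul_self_sqrt (norm_nonneg z)]
      field_simp
    have hb : √‖z - w‖ * ‖z - w‖⁻¹ = (√‖z - w‖)⁻¹ := by
      nth_rewrite 2 [← Real.mul_self_sqrt (norm_nonneg (z - w))]
      field_simp
    rw [← ha, ← hb]; ring
  rw [e]
  have : √‖w‖ * (‖z‖⁻¹ * ‖z - w‖⁻¹) ≤ 2 * (phiK z + phiK (z - w)) := by
    refine (mul_le_mul_of_nonneg_right hw (by positivity)).trans ?_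
    rw [e2]; linarith
  calc _ ≤ √‖w‖ * (2 * (phiK z + phiK (z - w))) := by gcongr
    _ = _ := by ring

lemma ae_ne_pt (w : ℂ) : ∀ᵐ z : ℂ, z ≠ w := by
  rw [ae_iff]; simp

lemma domin {F : ℂ → ℂ} (hF : Measurable F) (h0 : ∀ z, 1 < ‖z‖ → F z = 0) {w : ℂ} (hw : ‖w‖ ≤ 1)
    {M : ℝ} (hM : 0 ≤ M)
    (hb : ∀ z, z ≠ 0 → z ≠ w → ‖z‖ ≤ 1 → ‖F z‖ ≤ M * (phiK z + phiK (z - w))) :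
    Integrable F ∧ ‖∫ z, F z‖ ≤ M * (2 * KK) := by
  have i0 : IntegrableOn phiK (closedBall 0 1) := by simpa using phiK_sub_int (w := 0) (by simp)
  have l0 : ∫ z in closedBall (0:ℂ) 1, phiK z ≤ KK := by simpa using phiK_sub_le (w := 0) (by simp)
  have i1 := phiK_sub_int hw
  have l1 := phiK_sub_le hw
  have i2 : IntegrableOn (fun z => M * (phiK z + phiK (z - w))) (closedBall 0 1) := (i0.add i1).const_mul M
  have hae : ∀ᵐ z ∂(volume.restrict (closedBall (0:ℂ) 1)), ‖F z‖ ≤ M * (phiK z + phiK (z - w)) := by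
    filter_upwards [ae_restrict_of_ae (ae_ne_pt 0), ae_restrict_of_ae (ae_ne_pt w),
      ae_restrict_mem measurableSet_closedBall] with z h1 h2 h3
    exact hb z h1 h2 (mem_closedBall_zero_iff.1 h3)
  have iF : IntegrableOn F (closedBall 0 1) :=
    Integrable.mono' i2 hF.aestronglyMeasurable hae
  have hsupp : Function.support F ⊆ closedBall 0 1 := by
    intro z hz
    by_contra h
    rw [mem_closedBall_zero_iff, not_le] at h
    exact hz (h0 z h)
  refine ⟨(integrableOn_iff_integrable_of_support_subset hsupp).1 iF, ?_⟩
  rw [← setIntegral_eq_integral_of_forall_compl_eq_zero (s := closedBall 0 1)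
    (fun z hz => by by_contra h; exact hz (hsupp h))]
  refine (norm_integral_le_of_norm_le i2 hae).trans ?_
  rw [integral_const_mul, integral_add i0 i1]
  gcongr
  linarith

lemma T1 {f : ℂ → ℂ} (hf : Measurable f) (h0 : ∀ z, 1 < ‖z‖ → f z = 0) {w : ℂ} (hw : ‖w‖ ≤ 1)
    {M : ℝ} (hM : 0 ≤ M) (hb : ∀ z, z ≠ 0 → ‖z‖ ≤ 1 → ‖f z‖ ≤ M * (√‖z‖)⁻¹) :
    Integrable (fun z => f z / (z - w)) ∧ ‖∫ z, f z / (z - w)‖ ≤ M * (2 * KK) := by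
  refine domin (F := fun z => f z / (z - w)) (hf.div (measurable_id.sub_const w)) (fun z hz => by simp [h0 z hz]) hw hM ?_
  intro z hz hzw hz1
  rw [norm_div, div_eq_mul_inv]
  calc _ ≤ (M * (√‖z‖)⁻¹) * ‖z - w‖⁻¹ := by gcongr; exact hb z hz hz1
    _ = M * ((√‖z‖)⁻¹ * ‖z - w‖⁻¹) := by ring
    _ ≤ _ := by gcongr; exact aux1 _ _

lemma one_le_inv_sqrt {z : ℂ} (hz : z ≠ 0) (hz1 : ‖z‖ ≤ 1) : 1 ≤ (√‖z‖)⁻¹ :=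
  (one_le_inv₀ (Real.sqrt_pos.2 (norm_pos_iff.2 hz))).2 (Real.sqrt_le_one.2 hz1)

lemma T2 {f : ℂ → ℂ} (hf : Measurable f) (h0 : ∀ z, 1 < ‖z‖ → f z = 0) {w : ℂ} (hw : ‖w‖ ≤ 1)
    {M : ℝ} (hM : 0 ≤ M) (hb : ∀ z, z ≠ 0 → ‖z‖ ≤ 1 → ‖f z‖ ≤ M) :
    (∫ z, f z / (z - w)) - (∫ z, f z / z) = w * ∫ z, f z / z / (z - w) ∧
    ‖(∫ z, f z / (z - w)) - (∫ z, f z / z)‖ ≤ (4 * M * KK) * √‖w‖ := by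
  have hb' : ∀ z, z ≠ 0 → ‖z‖ ≤ 1 → ‖f z‖ ≤ M * (√‖z‖)⁻¹ := fun z hz hz1 =>
    (hb z hz hz1).trans (le_mul_of_one_le_right hM (one_le_inv_sqrt hz hz1))
  have i1 := (T1 hf h0 hw hM hb').1
  have i0 := (T1 hf h0 (w := 0) (by simp) hM hb').1
  simp only [sub_zero] at i0
  have e : (∫ z, f z / (z - w)) - (∫ z, f z / z) = ∫ z, w * (f z / z / (z - w)) := by
    rw [← integral_sub i1 i0]
    refine integral_congr_ae ?_
    filter_upwards [ae_ne_pt 0, ae_ne_pt w] with z h1 h2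
    have : z - w ≠ 0 := sub_ne_zero.2 h2
    field_simp
    ring
  refine ⟨by rw [e, integral_const_mul], ?_⟩
  rw [e]
  have := (domin (F := fun z => w * (f z / z / (z - w))) (M := M * (2 * √‖w‖)) (w := w)
    (((hf.div measurable_id).div (measurable_id.sub_const w)).const_mul w)
    (fun z hz => by simp [h0 z hz]) hw (by positivity) ?_).2
  · refine this.trans (le_of_eq ?_); ring
  intro z hz hzw hz1
  have h2 : z - w ≠ 0 := sub_ne_zero.2 hzw
  simp only [norm_mul, norm_inv, div_eq_mul_inv]
  calc ‖w‖ * (‖f z‖ * ‖z‖⁻¹ * ‖z - w‖⁻¹) = ‖f z‖ * (‖w‖ * (‖z‖⁻¹ * ‖z - w‖⁻¹)) := by ring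
    _ ≤ M * (2 * √‖w‖ * (phiK z + phiK (z - w))) := by
      exact mul_le_mul (hb z hz hz1) (aux2 z w hz h2) (by positivity) hM
    _ = _ := by ring

lemma core (P G : ℂ → ℂ) (c : ℂ) (C R M₀ : ℝ) (hR : 0 < R) (hR1 : R ≤ 1) (hC : 0 ≤ C)
    (hG : Measurable G) (hM₀ : ∀ z, ‖G z‖ ≤ M₀) (hG0 : ∀ z, 1 < ‖z‖ → G z = 0)
    (hrep : ∀ w, P w = c * ∫ z, G z / (z - w))
    (hGP : ∀ z, ‖z‖ < R → ‖G z‖ ≤ C * ‖P z‖)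
    (hsmall : ‖c‖ * (C * √(2 * R) * (2 * KK)) ≤ 1 / 2) :
    (∀ z, z ≠ 0 → ‖z‖ < R → P z = 0) ∨
      ∃ (k : ℕ) (a : ℂ), a ≠ 0 ∧ Tendsto (fun w => P w / w ^ k) (𝓝[≠] 0) (𝓝 a) := by
  have hM0 : 0 ≤ M₀ := (norm_nonneg _).trans (hM₀ 0)
  have hK := KK_nonneg
  by_cases hex : ∃ (k : ℕ) (a : ℂ), a ≠ 0 ∧ Tendsto (fun w => P w / w ^ k) (𝓝[≠] 0) (𝓝 a)
  · exact Or.inr hex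
  left
  push Not at hex
  have hmeas : ∀ k : ℕ, Measurable (fun z => G z / z ^ k) := fun k =>
    hG.div (measurable_id.pow_const k)
  have hz0 : ∀ k : ℕ, ∀ z, 1 < ‖z‖ → G z / z ^ k = 0 := fun k z hz => by simp [hG0 z hz]
  have S : ∀ k : ℕ, (∃ M, 0 ≤ M ∧ ∀ z, z ≠ 0 → ‖G z / z ^ k‖ ≤ M) ∧
      ∀ w, w ≠ 0 → ‖w‖ ≤ 1 → P w = w ^ k * (c * ∫ z, G z / z ^ k / (z - w)) := by
    intro k
    induction k with
    | zero => exact ⟨⟨M₀, hM0, fun z _ => by simpa using hM₀ z⟩, fun w _ _ => by simpa using hrep w⟩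
    | succ k ih =>
      obtain ⟨⟨M, hM, hMb⟩, hP⟩ := ih
      have t2 := fun w (hw : ‖w‖ ≤ 1) => T2 (hmeas k) (hz0 k) hw hM (fun z hz _ => hMb z hz)
      set I0 := ∫ z, G z / z ^ k / z with hI0
      have hlim : Tendsto (fun w => P w / w ^ k) (𝓝[≠] 0) (𝓝 (c * I0)) := by
        have h1 : Tendsto (fun w : ℂ => (4 * M * KK) * √‖w‖) (𝓝[≠] 0) (𝓝 0) := by
          have : Continuous (fun w : ℂ => (4 * M * KK) * √‖w‖) := by fun_prop
          have := this.tendsto 0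
          simp only [norm_zero, Real.sqrt_zero, mul_zero] at this
          exact this.mono_left nhdsWithin_le_nhds
        have hball : ∀ᶠ w : ℂ in 𝓝[≠] 0, w ≠ 0 ∧ ‖w‖ ≤ 1 := by
          filter_upwards [self_mem_nhdsWithin, nhdsWithin_le_nhds (closedBall_mem_nhds (0:ℂ) one_pos)] with w h1 h2
          exact ⟨h1, mem_closedBall_zero_iff.1 h2⟩
        have h2 : Tendsto (fun w => ∫ z, G z / z ^ k / (z - w)) (𝓝[≠] 0) (𝓝 I0) := by
          rw [tendsto_iff_norm_sub_tendsto_zero]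
          refine squeeze_zero' (Eventually.of_forall fun _ => norm_nonneg _) ?_ h1
          filter_upwards [hball] with w hw
          exact (t2 w hw.2).2
        refine (h2.const_mul c).congr' ?_
        filter_upwards [hball] with w hw
        rw [hP w hw.1 hw.2, mul_div_cancel_left₀ _ (pow_ne_zero _ hw.1)]
      have hc0 : c * I0 = 0 := by
        by_contra h
        exact hex k _ h hlim
      have hrep1 : ∀ w, w ≠ 0 → ‖w‖ ≤ 1 → P w = w ^ (k+1) * (c * ∫ z, G z / z ^ (k+1) / (z - w)) := by
        intro w hw hw1
        have h1 := (t2 w hw1).1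
        simp only [div_div, ← pow_succ] at h1 
        rw [hP w hw hw1]
        simp only [div_div, ← pow_succ] at hI0 ⊢
        rw [sub_eq_iff_eq_add] at h1
        rw [h1, mul_add, hc0]; ring
      have hPb : ∀ w, w ≠ 0 → ‖w‖ ≤ 1 → ‖P w‖ ≤ ‖w‖ ^ k * (‖c‖ * ((4 * M * KK) * √‖w‖)) := by
        intro w hw hw1
        have : P w = w ^ k * (c * ((∫ z, G z / z ^ k / (z - w)) - I0)) := by
          rw [mul_sub, hc0, sub_zero, hP w hw hw1]
        rw [this, norm_mul, norm_mul, norm_pow]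
        gcongr
        exact (t2 w hw1).2
      -- general improvement
      have hfar : ∀ z, z ≠ 0 → R ≤ ‖z‖ → ‖G z / z ^ (k+1)‖ ≤ M₀ / R ^ (k+1) := by
        intro z hz hzR
        rw [norm_div, norm_pow]
        gcongr
        exact hM₀ z
      set M1 := C * (‖c‖ * (4 * M * KK)) + M₀ / R ^ (k+1) with hM1
      have hM1n : 0 ≤ M1 := by positivity
      have hb1 : ∀ z, z ≠ 0 → ‖z‖ ≤ 1 → ‖G z / z ^ (k+1)‖ ≤ M1 * (√‖z‖)⁻¹ := by
        intro z hz hz1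
        have hzp : 0 < ‖z‖ := norm_pos_iff.2 hz
        rcases lt_or_ge ‖z‖ R with h | h
        · have h1 := (hGP z h).trans (mul_le_mul_of_nonneg_left (hPb z hz hz1) hC)
          rw [norm_div, norm_pow, div_le_iff₀ (by positivity)]
          refine h1.trans ?_
          have e : (√‖z‖)⁻¹ * ‖z‖ ^ (k+1) = ‖z‖ ^ k * √‖z‖ := by
            have hs : 0 < √‖z‖ := Real.sqrt_pos.2 hzp
            rw [pow_succ]
            nth_rewrite 3 [← Real.mul_self_sqrt hzp.le]
            field_simp
          rw [mul_assoc M1, e]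
          calc _ = C * (‖c‖ * (4 * M * KK)) * (‖z‖ ^ k * √‖z‖) := by ring
            _ ≤ _ := by
              gcongr
              rw [hM1]
              exact le_add_of_nonneg_right (by positivity)
        · refine (hfar z hz h).trans ?_
          calc _ ≤ M1 := by rw [hM1]; exact le_add_of_nonneg_left (by positivity)
            _ ≤ _ := le_mul_of_one_le_right hM1n (one_le_inv_sqrt hz hz1)
      refine ⟨⟨C * (‖c‖ * (M1 * (2 * KK))) + M₀ / R ^ (k+1), by positivity, fun z hz => ?_⟩, hrep1⟩
      rcases lt_or_ge ‖z‖ R with h | h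
      · have hzp : 0 < ‖z‖ := norm_pos_iff.2 hz
        have h1 := hGP z h
        rw [hrep1 z hz (h.le.trans hR1), norm_mul, norm_mul, norm_pow] at h1
        have h2 := (T1 (hmeas (k+1)) (hz0 (k+1)) (h.le.trans hR1) hM1n hb1).2
        rw [norm_div, norm_pow, div_le_iff₀ (by positivity)]
        refine h1.trans ?_
        calc _ ≤ C * (‖z‖ ^ (k+1) * (‖c‖ * (M1 * (2 * KK)))) := by gcongr
          _ = (C * (‖c‖ * (M1 * (2 * KK)))) * ‖z‖ ^ (k+1) := by ring
          _ ≤ _ := by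
            gcongr
            exact le_add_of_nonneg_right (by positivity)
      · exact (hfar z hz h).trans (le_add_of_nonneg_left (by positivity))
  -- infinite order vanishing
  set A := ‖c‖ * (M₀ * √2 * (2 * KK)) with hA
  have hA0 : 0 ≤ A := by positivity
  have hfin : ∀ k : ℕ, ∀ w, w ≠ 0 → ‖w‖ < R → ‖P w‖ ≤ ‖w‖ ^ k * (2 * (A / R ^ k)) := by
    intro k
    obtain ⟨⟨M, hM, hMb⟩, hP⟩ := S k
    have improve : ∀ N, 0 ≤ N → (∀ w, w ≠ 0 → ‖w‖ < R → ‖P w‖ ≤ ‖w‖ ^ k * N) →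
        ∀ w, w ≠ 0 → ‖w‖ < R → ‖P w‖ ≤ ‖w‖ ^ k * (N / 2 + A / R ^ k) := by
      intro N hN hNb w hw hwR
      have hw1 : ‖w‖ ≤ 1 := hwR.le.trans hR1
      rw [hP w hw hw1, norm_mul, norm_mul, norm_pow]
      gcongr
      have h1 := (domin (F := fun z => G z / z ^ k / (z - w)) (w := w)
        (M := C * N * √(2 * R) + M₀ / R ^ k * √2)
        ((hmeas k).div (measurable_id.sub_const w)) (fun z hz => by simp [hG0 z hz]) hw1
        (by positivity) ?_).2
      · calc _ ≤ ‖c‖ * ((C * N * √(2 * R) + M₀ / R ^ k * √2) * (2 * KK)) := by gcongr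
          _ = N * (‖c‖ * (C * √(2 * R) * (2 * KK))) + A / R ^ k := by rw [hA]; ring
          _ ≤ N * (1/2) + A / R ^ k := by gcongr
          _ = _ := by ring
      intro z hz hzw hz1
      have hzp : 0 < ‖z‖ := norm_pos_iff.2 hz
      have hzwp : 0 < ‖z - w‖ := norm_pos_iff.2 (sub_ne_zero.2 hzw)
      have hinv : ∀ B, ‖z - w‖ ≤ B → ‖z - w‖⁻¹ ≤ √B * (phiK z + phiK (z - w)) := by
        intro B hB
        have h3 : √‖z - w‖ ≤ √B := Real.sqrt_le_sqrt hB
        have h4 : ‖z - w‖⁻¹ = √‖z - w‖ * phiK (z - w) := by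
          have : 0 < √‖z - w‖ := Real.sqrt_pos.2 hzwp
          rw [phiK]; field_simp
        rw [h4]
        gcongr
        · exact phiK_nonneg _
        · exact le_add_of_nonneg_left (phiK_nonneg _)
      have hph : 0 ≤ phiK z + phiK (z - w) := add_nonneg (phiK_nonneg _) (phiK_nonneg _)
      have htri := norm_sub_le z w
      rw [norm_div, div_eq_mul_inv]
      rcases lt_or_ge ‖z‖ R with h | h
      · have h5 : ‖G z / z ^ k‖ ≤ C * N := by
          rw [norm_div, norm_pow, div_le_iff₀ (by positivity)]
          calc _ ≤ C * ‖P z‖ := hGP z h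
            _ ≤ C * (‖z‖ ^ k * N) := by gcongr; exact hNb z hz h
            _ = _ := by ring
        calc _ ≤ (C * N) * (√(2 * R) * (phiK z + phiK (z - w))) := by
              gcongr
              exact hinv _ (by linarith)
          _ ≤ (C * N) * (√(2 * R) * (phiK z + phiK (z - w))) + M₀ / R ^ k * √2 * (phiK z + phiK (z - w)) :=
              le_add_of_nonneg_right (by positivity)
          _ = _ := by ring
      · have h5 : ‖G z / z ^ k‖ ≤ M₀ / R ^ k := by
          rw [norm_div, norm_pow]
          gcongr
          exact hM₀ z
        calc _ ≤ (M₀ / R ^ k) * (√2 * (phiK z + phiK (z - w))) := by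
              gcongr
              exact hinv _ (by linarith)
          _ ≤ (M₀ / R ^ k) * (√2 * (phiK z + phiK (z - w))) + C * N * √(2 * R) * (phiK z + phiK (z - w)) :=
              le_add_of_nonneg_right (by positivity)
          _ = _ := by ring
    -- initial bound
    have init : ∃ N, 0 ≤ N ∧ ∀ w, w ≠ 0 → ‖w‖ < R → ‖P w‖ ≤ ‖w‖ ^ k * N := by
      refine ⟨‖c‖ * (M * (2 * KK)), by positivity, fun w hw hwR => ?_⟩
      have hw1 : ‖w‖ ≤ 1 := hwR.le.trans hR1
      rw [hP w hw hw1, norm_mul, norm_mul, norm_pow]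
      gcongr
      exact (T1 (hmeas k) (hz0 k) hw1 hM (fun z hz hz1 => (hMb z hz).trans
        (le_mul_of_one_le_right hM (one_le_inv_sqrt hz hz1)))).2
    obtain ⟨N, hN, hNb⟩ := init
    have hB0 : 0 ≤ A / R ^ k := by positivity
    have iter : ∀ n : ℕ, ∀ w, w ≠ 0 → ‖w‖ < R → ‖P w‖ ≤ ‖w‖ ^ k * (N * (1/2) ^ n + 2 * (A / R ^ k)) := by
      intro n
      induction n with
      | zero =>
        intro w hw hwR
        refine (hNb w hw hwR).trans ?_
        gcongr
        simp only [pow_zero, mul_one]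
        linarith
      | succ n ih =>
        intro w hw hwR
        refine (improve _ (by positivity) ih w hw hwR).trans (le_of_eq ?_)
        rw [pow_succ]; ring
    intro w hw hwR
    have hl : Tendsto (fun n : ℕ => ‖w‖ ^ k * (N * (1/2:ℝ) ^ n + 2 * (A / R ^ k))) atTop
        (𝓝 (‖w‖ ^ k * (N * 0 + 2 * (A / R ^ k)))) :=
      (((tendsto_pow_atTop_nhds_zero_of_lt_one (by norm_num) (by norm_num)).const_mul N).add_const _).const_mul _
    have := ge_of_tendsto' hl (fun n => iter n w hw hwR)
    simpa using this
  intro w hw hwR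
  have hl : Tendsto (fun k : ℕ => (‖w‖ / R) ^ k * (2 * A)) atTop (𝓝 (0 * (2 * A))) :=
    (tendsto_pow_atTop_nhds_zero_of_lt_one (by positivity) ((div_lt_one hR).2 hwR)).mul_const _
  have := ge_of_tendsto' hl (fun k => (hfin k w hw hwR).trans (le_of_eq (by rw [div_pow]; ring)))
  rw [zero_mul] at this
  exact norm_le_zero_iff.1 this

lemma local0 (Q : ℂ → ℂ) (r C : ℝ) (hr : 0 < r) (hC : 0 ≤ C) (hQ : ContDiffOn ℝ 1 Q (ball 0 r))
    (hb : ∀ z ∈ ball (0:ℂ) r, ‖dbar Q z‖ ≤ C * ‖Q z‖) (hQ0 : Q 0 = 0) :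
    (∀ᶠ z in 𝓝 0, Q z = 0) ∨
      ∃ (k : ℕ) (a : ℂ), a ≠ 0 ∧ Tendsto (fun w => Q w / w ^ k) (𝓝[≠] 0) (𝓝 a) := by
  set c : ℂ := -(Real.pi : ℂ)⁻¹ with hc
  obtain ⟨R, hR, hRr, hR1, hRs⟩ : ∃ R : ℝ, 0 < R ∧ 2 * R < r ∧ 2 * R < 1 ∧
      ‖c‖ * (C * √(2 * R) * (2 * KK)) < 1 / 2 := by
    have h1 : ∀ᶠ R : ℝ in 𝓝[>] 0, 2 * R < r := by
      have : Continuous fun R : ℝ => 2 * R := by fun_prop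
      exact nhdsWithin_le_nhds ((this.tendsto 0).eventually (gt_mem_nhds (by simpa using hr)))
    have h2 : ∀ᶠ R : ℝ in 𝓝[>] 0, 2 * R < 1 := by
      have : Continuous fun R : ℝ => 2 * R := by fun_prop
      exact nhdsWithin_le_nhds ((this.tendsto 0).eventually (gt_mem_nhds (by simp)))
    have h3 : ∀ᶠ R : ℝ in 𝓝[>] 0, ‖c‖ * (C * √(2 * R) * (2 * KK)) < 1 / 2 := by
      have : Continuous fun R : ℝ => ‖c‖ * (C * √(2 * R) * (2 * KK)) := by fun_prop
      exact nhdsWithin_le_nhds ((this.tendsto 0).eventually (gt_mem_nhds (by simp)))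
    have h4 : ∀ᶠ R : ℝ in 𝓝[>] 0, 0 < R := self_mem_nhdsWithin
    obtain ⟨R, a1, a2, a3, a4⟩ := (h1.and (h2.and (h3.and h4))).exists
    exact ⟨R, a4, a1, a2, a3⟩
  let χ : ContDiffBump (0:ℂ) := ⟨R, 2 * R, hR, by linarith⟩
  set P : ℂ → ℂ := fun z => χ z • Q z with hP
  have hPs : ∀ z, 2 * R < ‖z‖ → P =ᶠ[𝓝 z] fun _ => 0 := by
    intro z hz
    filter_upwards [(isOpen_lt continuous_const continuous_norm).mem_nhds hz] with y hy
    have : χ y = 0 := χ.zero_of_le_dist (by simpa [χ] using le_of_lt hy)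
    simp [hP, this]
  have hPcd : ContDiff ℝ 1 P := by
    rw [contDiff_iff_contDiffAt]
    intro z
    rcases lt_or_ge ‖z‖ r with h | h
    · exact χ.contDiffAt.smul (hQ.contDiffAt (isOpen_ball.mem_nhds (mem_ball_zero_iff.2 h)))
    · exact contDiffAt_const.congr_of_eventuallyEq (hPs z (by linarith))
  have hPc : HasCompactSupport P := χ.hasCompactSupport.smul_right
  have hPQ : ∀ z, ‖z‖ < R → P =ᶠ[𝓝 z] Q := by
    intro z hz
    filter_upwards [χ.eventuallyEq_one_of_mem_ball (x := z) (by simpa [χ] using hz)] with y hy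
    simp [hP, hy]
  have hGc : Continuous (dbar P) := by
    have := hPcd.continuous_fderiv (by norm_num)
    unfold dbar
    fun_prop
  have hG0 : ∀ z, 2 * R < ‖z‖ → dbar P z = 0 := by
    intro z hz
    simp [dbar, (hPs z hz).fderiv_eq]
  obtain ⟨M₀, hM₀⟩ := hGc.bounded_above_of_compact_support
    (HasCompactSupport.intro (isCompact_closedBall (0:ℂ) (2 * R)) fun z hz => hG0 z (by simpa using hz))
  rcases core P (dbar P) c C R M₀ hR (by linarith) hC hGc.measurable hM₀
    (fun z hz => hG0 z (by linarith)) (fun w => pompeiu P hPcd hPc w) (fun z hz => by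
      have h1 := hb z (mem_ball_zero_iff.2 (by linarith))
      rw [(hPQ z hz).eq_of_nhds]
      simpa [dbar, (hPQ z hz).fderiv_eq] using h1) hRs.le with h | ⟨k, a, ha, hl⟩
  · left
    filter_upwards [ball_mem_nhds (0:ℂ) hR] with z hz
    rw [mem_ball_zero_iff] at hz
    rcases eq_or_ne z 0 with rfl | h0
    · exact hQ0
    · rw [← (hPQ z hz).eq_of_nhds]; exact h z h0 hz
  · right
    refine ⟨k, a, ha, hl.congr' ?_⟩
    filter_upwards [nhdsWithin_le_nhds (hPQ 0 (by simpa using hR))] with z hz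
    rw [hz]

lemma localz (U : Set ℂ) (hU : IsOpen U) (Q : ℂ → ℂ) (hQ : ContDiffOn ℝ 1 Q U) (b : ℂ → ℝ)
    (hbc : ContinuousOn b U) (hb : ∀ z ∈ U, ‖dbar Q z‖ ≤ b z * ‖Q z‖) (z₀ : ℂ) (hz₀ : z₀ ∈ U)
    (hQ0 : Q z₀ = 0) :
    (∀ᶠ z in 𝓝 z₀, Q z = 0) ∨
      ((∃ V ∈ nhds z₀, ∀ z ∈ V, z ≠ z₀ → Q z ≠ 0) ∧
        ∃ (k : ℕ), 0 < k ∧ ∃ V ∈ nhds z₀,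
          ∃ g₀ : ℂ → ℂ, ContinuousOn g₀ V ∧ (∀ z ∈ V, g₀ z ≠ 0) ∧
            ∀ z ∈ V, Q z = (z - z₀) ^ k * g₀ z) := by
  have hbca : ContinuousAt b z₀ := hbc.continuousAt (hU.mem_nhds hz₀)
  have hev : ∀ᶠ z in 𝓝 z₀, z ∈ U ∧ b z < |b z₀| + 1 :=
    Filter.Eventually.and (hU.mem_nhds hz₀) (hbca.eventually (gt_mem_nhds (by linarith [le_abs_self (b z₀)])))
  obtain ⟨r, hr, hrb⟩ := Metric.eventually_nhds_iff.1 hev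
  have hmem : ∀ z ∈ ball (0:ℂ) r, dist (z₀ + z) z₀ < r := fun z hz => by
    simpa [dist_eq_norm] using hz
  have hloc := local0 (fun z => Q (z₀ + z)) r (|b z₀| + 1) hr (by positivity)
    (hQ.comp (contDiff_const.add contDiff_id).contDiffOn (fun z hz => (hrb (hmem z hz)).1))
    (fun z hz => by
      have h1 := hb (z₀ + z) (hrb (hmem z hz)).1
      have h2 : dbar (fun z => Q (z₀ + z)) z = dbar Q (z₀ + z) := by
        simp [dbar, fderiv_comp_add_left]
      rw [h2]
      exact h1.trans (mul_le_mul_of_nonneg_right (hrb (hmem z hz)).2.le (norm_nonneg _)))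
    (by simpa using hQ0)
  have hsub : Tendsto (fun z => z - z₀) (𝓝 z₀) (𝓝 0) := by
    have : Continuous fun z => z - z₀ := by fun_prop
    simpa using this.tendsto z₀
  rcases hloc with h | ⟨k, a, ha, hl⟩
  · left
    have := hsub.eventually h
    simpa using this
  right
  have hsub' : Tendsto (fun z => z - z₀) (𝓝[≠] z₀) (𝓝[≠] 0) := by
    refine tendsto_nhdsWithin_iff.2 ⟨hsub.mono_left nhdsWithin_le_nhds, ?_⟩
    filter_upwards [self_mem_nhdsWithin] with z hz
    exact sub_ne_zero.2 hz
  have hl2 : Tendsto (fun z => Q z / (z - z₀) ^ k) (𝓝[≠] z₀) (𝓝 a) := by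
    simpa [Function.comp_def] using hl.comp hsub'
  have hk : 0 < k := by
    rcases Nat.eq_zero_or_pos k with rfl | h
    · exfalso
      have hc := (hQ.continuousOn.continuousAt (hU.mem_nhds hz₀)).tendsto.mono_left
        (nhdsWithin_le_nhds (s := {z₀}ᶜ))
      simp only [pow_zero, div_one] at hl2
      exact ha ((tendsto_nhds_unique hl2 hc).trans hQ0)
    · exact h
  set g₀ : ℂ → ℂ := Function.update (fun z => Q z / (z - z₀) ^ k) z₀ a with hg₀
  have hgz : g₀ z₀ = a := by simp [hg₀]
  have hgn : ∀ z, z ≠ z₀ → g₀ z = Q z / (z - z₀) ^ k := fun z hz => by simp [hg₀, hz]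
  have hgc0 : ContinuousAt g₀ z₀ := continuousAt_update_same.2 hl2
  have hV : {z | z ∈ U ∧ g₀ z ≠ 0} ∈ 𝓝 z₀ :=
    Filter.Eventually.and (hU.mem_nhds hz₀) (hgc0.eventually_ne (by rw [hgz]; exact ha))
  refine ⟨⟨_, hV, fun z hz hne h0 => hz.2 (by rw [hgn z hne, h0, zero_div])⟩, k, hk, _, hV, g₀,
    ?_, fun z hz => hz.2, ?_⟩
  · intro z hz
    apply ContinuousAt.continuousWithinAt
    rcases eq_or_ne z z₀ with rfl | hne
    · exact hgc0
    · have h1 : ContinuousAt (fun z => Q z / (z - z₀) ^ k) z :=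
        (hQ.continuousOn.continuousAt (hU.mem_nhds hz.1)).div (by fun_prop)
          (pow_ne_zero _ (sub_ne_zero.2 hne))
      refine h1.congr ?_
      filter_upwards [isOpen_ne.mem_nhds hne] with y hy
      exact (hgn y hy).symm
  · intro z hz
    rcases eq_or_ne z z₀ with rfl | hne
    · simp [hQ0, hk.ne']
    · rw [hgn z hne, mul_div_cancel₀]
      exact pow_ne_zero _ (sub_ne_zero.2 hne)

end helpers


/-- For a Codazzi pair on a connected open set `U` written in a conformal parameter,
if `‖dH‖_A ≤ h √q` for a continuous `h` (with `q = H² - K_e` the skew curvature),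
then either `Q` vanishes identically on `U`, or each zero `z₀` of `Q` is isolated
and `Q(z) = (z - z₀)^k g₀(z)` near `z₀` with `k` a positive integer and `g₀`
continuous and nonvanishing. -/
theorem codazzi_umbilic_isolated
    (U : Set ℂ) (hUopen : IsOpen U) (hUconn : IsConnected U)
    (lam e f g : ℂ → ℝ)
    (hlam : ContDiffOn ℝ 1 lam U) (he : ContDiffOn ℝ 1 e U)
    (hf : ContDiffOn ℝ 1 f U) (hg : ContDiffOn ℝ 1 g U)
    (hpos : ∀ z ∈ U, 0 < lam z)
    (hcod1 : ∀ z ∈ U, pv e z - pu f z = (e z + g z) * pv lam z / (2 * lam z))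
    (hcod2 : ∀ z ∈ U, pv f z - pu g z = -((e z + g z) * pu lam z / (2 * lam z)))
    (H Ke q : ℂ → ℝ)
    (hH : ∀ z, H z = (e z + g z) / (4 * lam z))
    (hKe : ∀ z, Ke z = (e z * g z - f z ^ 2) / (4 * lam z ^ 2))
    (hq : ∀ z, q z = H z ^ 2 - Ke z)
    (Q : ℂ → ℂ)
    (hQ : ∀ z, Q z = (((e z - g z) / 4 : ℝ) : ℂ) - Complex.I * ((f z / 2 : ℝ) : ℂ))
    (h : ℂ → ℝ) (hh : ContinuousOn h U)
    (hbound : ∀ z ∈ U, normdA lam H z ≤ h z * Real.sqrt (q z)) :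
    (∀ z ∈ U, Q z = 0) ∨
      (∀ z₀ ∈ U, Q z₀ = 0 →
        (∃ V ∈ nhds z₀, ∀ z ∈ V, z ≠ z₀ → Q z ≠ 0) ∧
        ∃ (k : ℕ), 0 < k ∧ ∃ V ∈ nhds z₀,
          ∃ g₀ : ℂ → ℂ, ContinuousOn g₀ V ∧ (∀ z ∈ V, g₀ z ≠ 0) ∧
            ∀ z ∈ V, Q z = (z - z₀) ^ k * g₀ z) := by
  have hda : ∀ (ψ : ℂ → ℝ), ContDiffOn ℝ 1 ψ U → ∀ z ∈ U, DifferentiableAt ℝ ψ z :=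
    fun ψ hψ z hz => (hψ.differentiableOn (by norm_num)).differentiableAt (hUopen.mem_nhds hz)
  have hQeq : Q = fun z => (((e z - g z) / 4 : ℝ) : ℂ) - Complex.I * ((f z / 2 : ℝ) : ℂ) := funext hQ
  have hQcd : ContDiffOn ℝ 1 Q U := by
    rw [hQeq]
    have h1 : ContDiffOn ℝ 1 (fun z => (((e z - g z) / 4 : ℝ) : ℂ)) U :=
      Complex.ofRealCLM.contDiff.comp_contDiffOn ((he.sub hg).div_const 4)
    have h2 : ContDiffOn ℝ 1 (fun z => ((f z / 2 : ℝ) : ℂ)) U :=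
      Complex.ofRealCLM.contDiff.comp_contDiffOn (hf.div_const 2)
    exact h1.sub (contDiffOn_const.mul h2)
  have hQd : ∀ z ∈ U, ∀ v, fderiv ℝ Q z v =
      (((fderiv ℝ e z v - fderiv ℝ g z v) / 4 : ℝ) : ℂ) - Complex.I * ((fderiv ℝ f z v / 2 : ℝ) : ℂ) := by
    intro z hz v
    have a1 := (hda e he z hz).hasFDerivAt
    have a2 := (hda g hg z hz).hasFDerivAt
    have a3 := (hda f hf z hz).hasFDerivAt
    have h1 := (Complex.ofRealCLM.hasFDerivAt (x := (e z - g z) * (4:ℝ)⁻¹)).comp z ((a1.sub a2).mul_const (4:ℝ)⁻¹)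
    have h2 := (Complex.ofRealCLM.hasFDerivAt (x := f z * (2:ℝ)⁻¹)).comp z (a3.mul_const (2:ℝ)⁻¹)
    have h3 := h1.sub (h2.const_mul Complex.I)
    have h5 := h3.fderiv
    have h6 : Q = (⇑Complex.ofRealCLM ∘ fun y => (e y - g y) * 4⁻¹) -
        fun y => Complex.I * (⇑Complex.ofRealCLM ∘ fun y => f y * 2⁻¹) y := by
      rw [hQeq]; rfl
    rw [h6]
    erw [h5]
    simp
    ring
  have hHd : ∀ z ∈ U, ∀ v, fderiv ℝ e z v + fderiv ℝ g z v =
      4 * (lam z * fderiv ℝ H z v + H z * fderiv ℝ lam z v) := by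
    intro z hz v
    have a1 := hda e he z hz
    have a2 := hda g hg z hz
    have a4 := hda lam hlam z hz
    have hl := (hpos z hz).ne'
    have hHdiff : DifferentiableAt ℝ H z := by
      rw [funext hH]
      have hne : 4 * lam z ≠ 0 := mul_ne_zero (by norm_num) hl
      have a5 : DifferentiableAt ℝ (fun z => 4 * lam z) z := a4.const_mul (4:ℝ)
      have a6 : DifferentiableAt ℝ (fun z => e z + g z) z := a1.add a2
      simp only [div_eq_mul_inv]
      exact a6.mul (a5.fun_inv hne)
    have ev : (fun z => e z + g z) =ᶠ[nhds z] fun z => 4 * (lam z * H z) := by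
      filter_upwards [hUopen.mem_nhds hz] with y hy
      have := (hpos y hy).ne'
      rw [hH]; field_simp
    have h1 := ev.fderiv_eq (𝕜 := ℝ)
    have h2 : fderiv ℝ (fun z => e z + g z) z = fderiv ℝ e z + fderiv ℝ g z := fderiv_fun_add a1 a2
    have h3 := ((a4.hasFDerivAt.mul hHdiff.hasFDerivAt).const_mul (4:ℝ)).fderiv
    have h5 := h3
    erw [h5] at h1
    rw [h2] at h1
    have := congrArg (fun L : ℂ →L[ℝ] ℝ => L v) h1
    simpa [mul_add] using this
  have hbd : ∀ z ∈ U, ‖dbar Q z‖ ≤ (Real.sqrt (2 * lam z) / 2 * h z) * ‖Q z‖ := by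
    intro z hz
    have hl := hpos z hz
    have c1 := hcod1 z hz
    have c2 := hcod2 z hz
    have d1 := hHd z hz 1
    have d2 := hHd z hz Complex.I
    have hb := hbound z hz
    change pu e z + pu g z = 4 * (lam z * pu H z + H z * pu lam z) at d1
    change pv e z + pv g z = 4 * (lam z * pv H z + H z * pv lam z) at d2
    have hs : e z + g z = 4 * (lam z * H z) := by rw [hH]; field_simp
    have c1' : pv e z - pu f z = 2 * H z * pv lam z := by
      rw [c1, hs]; field_simp; ring
    have c2' : pv f z - pu g z = -(2 * H z * pu lam z) := by
      rw [c2, hs]; field_simp; ring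
    have hdb : dbar Q z = ((lam z / 2 * pu H z : ℝ) : ℂ) + ((-(lam z / 2 * pv H z) : ℝ) : ℂ) * Complex.I := by
      rw [dbar, hQd z hz, hQd z hz]
      change (((((pu e z - pu g z) / 4 : ℝ) : ℂ) - Complex.I * ((pu f z / 2 : ℝ) : ℂ)) +
        Complex.I * ((((pv e z - pv g z) / 4 : ℝ) : ℂ) - Complex.I * ((pv f z / 2 : ℝ) : ℂ))) / 2 = _
      apply Complex.ext
      · simp; linarith
      · simp; linarith
    have hn : ‖dbar Q z‖ = lam z / 2 * Real.sqrt (2 * lam z) * normdA lam H z := by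
      rw [hdb, Complex.norm_add_mul_I, normdA, mul_assoc, ← Real.sqrt_mul (by positivity),
        mul_div_cancel₀ _ (by positivity)]
      rw [show (lam z / 2 * pu H z) ^ 2 + (-(lam z / 2 * pv H z)) ^ 2 =
        (lam z / 2) ^ 2 * (pu H z ^ 2 + pv H z ^ 2) by ring, Real.sqrt_mul (by positivity),
        Real.sqrt_sq (by positivity)]
    have hQn : ‖Q z‖ = lam z * Real.sqrt (q z) := by
      have : Q z = (((e z - g z) / 4 : ℝ) : ℂ) + ((-(f z / 2) : ℝ) : ℂ) * Complex.I := by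
        rw [hQ]; push_cast; ring
      rw [this, Complex.norm_add_mul_I]
      have e1 : ((e z - g z) / 4) ^ 2 + (-(f z / 2)) ^ 2 = lam z ^ 2 * q z := by
        rw [hq, hKe, hH]; field_simp; ring
      rw [e1, Real.sqrt_mul (by positivity), Real.sqrt_sq hl.le]
    rw [hn, hQn]
    calc _ ≤ lam z / 2 * Real.sqrt (2 * lam z) * (h z * Real.sqrt (q z)) := by gcongr
      _ = _ := by ring
  have hbc : ContinuousOn (fun z => Real.sqrt (2 * lam z) / 2 * h z) U :=
    ((continuousOn_const.mul hlam.continuousOn).sqrt.div_const 2).mul hh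
  have hdich := localz U hUopen Q hQcd _ hbc hbd
  by_cases hz : ∃ z ∈ U, ∀ᶠ y in nhds z, Q y = 0
  · left
    obtain ⟨z₁, hz₁, hev⟩ := hz
    have hsub : U ⊆ {z | ∀ᶠ y in nhds z, Q y = 0} := by
      refine hUconn.isPreconnected.subset_of_closure_inter_subset isOpen_setOfPred_eventually_nhds
        ⟨z₁, hz₁, hev⟩ ?_
      rintro z ⟨hzc, hzU⟩
      have hzc' := mem_closure_iff_nhds.1 hzc
      have hQz : Q z = 0 := by
        by_contra hne
        have hca := hQcd.continuousOn.continuousAt (hUopen.mem_nhds hzU)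
        obtain ⟨y, hy1, hy2⟩ := hzc' _ (hca.eventually_ne hne)
        exact hy1 (Filter.Eventually.self_of_nhds (p := fun t => Q t = 0) hy2)
      rcases hdich z hzU hQz with h1 | ⟨⟨V, hV, hVn⟩, -⟩
      · exact h1
      · obtain ⟨y, hy1, hy2⟩ := hzc' V hV
        have hQy : Q y = 0 := Filter.Eventually.self_of_nhds (p := fun t => Q t = 0) hy2
        have : y = z := by
          by_contra hne
          exact hVn y hy1 hne hQy
        rwa [this] at hy2
    exact fun z hz => Filter.Eventually.self_of_nhds (p := fun t => Q t = 0) (hsub hz)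
  · right
    intro z₀ hz₀ hQ0
    rcases hdich z₀ hz₀ hQ0 with h1 | h1
    · exact absurd ⟨z₀, hz₀, h1⟩ hz
    · exact h1
end

section
/- Suppose U is connected, the Codazzi equations ∂_v e − ∂_u f = (e+g)(∂_v λ)/(2λ) and ∂_v f − ∂_u g = −(e+g)(∂_u λ)/(2λ) hold on U, the extrinsic curvature K_e is a positive constant c on U, and H > 0 on U. Then either Q vanishes identically on U, or every zero of Q in U is isolated. -/
open MeasureTheory Set Filter Topology

noncomputable def dbarC (φ : ℂ → ℂ) (z : ℂ) : ℂ :=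
  (fderiv ℝ φ z 1 + Complex.I * fderiv ℝ φ z Complex.I) / 2

lemma lint_inv_ball (r : ℝ) (hr : 0 ≤ r) (a : ℂ) :
    ∫⁻ z in Metric.ball a r, ‖(z - a)⁻¹‖ₑ ≤ ENNReal.ofReal (2 * Real.pi * r) := by
  have h1 : ∫⁻ z in Metric.ball a r, ‖(z - a)⁻¹‖ₑ
      = ∫⁻ z : ℂ, (Metric.ball (0:ℂ) r).indicator (fun z => ‖z⁻¹‖ₑ) z := by
    rw [← lintegral_indicator Metric.isOpen_ball.measurableSet,
      ← lintegral_sub_right_eq_self ((Metric.ball (0:ℂ) r).indicator (fun z => ‖z⁻¹‖ₑ)) a]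
    congr 1
    ext z
    simp [indicator, dist_eq_norm]
  rw [h1, ← Complex.lintegral_comp_polarCoord_symm]
  calc _ ≤ ∫⁻ p in polarCoord.target, (Ioo 0 r ×ˢ Ioo (-Real.pi) Real.pi).indicator 1 p := by
        refine setLIntegral_mono' polarCoord.open_target.measurableSet ?_
        rintro ⟨s, θ⟩ hp
        simp only [polarCoord_target, mem_prod, mem_Ioi] at hp
        by_cases hs : s < r
        · have hm : (s, θ) ∈ (Ioo 0 r ×ˢ Ioo (-Real.pi) Real.pi) := ⟨⟨hp.1, hs⟩, hp.2⟩
          rw [indicator_of_mem hm, indicator_of_mem]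
          · rw [← ofReal_norm, norm_inv, Complex.norm_polarCoord_symm, smul_eq_mul,
              ← ENNReal.ofReal_mul hp.1.le, abs_of_pos hp.1, mul_inv_cancel₀ hp.1.ne']
            simp
          · rw [mem_ball_zero_iff, Complex.norm_polarCoord_symm, abs_of_pos hp.1]; exact hs
        · rw [indicator_of_notMem]
          · simp
          · rw [mem_ball_zero_iff, Complex.norm_polarCoord_symm, abs_of_pos hp.1]; exact hs
    _ ≤ ∫⁻ p : ℝ × ℝ, (Ioo 0 r ×ˢ Ioo (-Real.pi) Real.pi).indicator 1 p := setLIntegral_le_lintegral _ _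
    _ = _ := by
        rw [lintegral_indicator_one (measurableSet_Ioo.prod measurableSet_Ioo), Measure.volume_eq_prod,
          Measure.prod_prod, Real.volume_Ioo, Real.volume_Ioo, ← ENNReal.ofReal_mul (by linarith)]
        congr 1; ring

lemma integrableOn_inv_ball (r : ℝ) (a : ℂ) :
    IntegrableOn (fun z : ℂ => (z - a)⁻¹) (Metric.ball a r) := by
  refine ⟨by fun_prop, ?_⟩
  have := lint_inv_ball |r| (abs_nonneg r) a
  refine lt_of_le_of_lt (le_trans (lintegral_mono_set ?_) this) ENNReal.ofReal_lt_top
  exact Metric.ball_subset_ball (le_abs_self r)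

lemma dbarC_cont {φ : ℂ → ℂ} (h : ContDiff ℝ 1 φ) : Continuous (dbarC φ) := by
  have := h.continuous_fderiv one_ne_zero
  unfold dbarC
  fun_prop

lemma dbarC_supp {φ : ℂ → ℂ} (h : HasCompactSupport φ) : HasCompactSupport (dbarC φ) := by
  refine (h.fderiv ℝ).mono ?_
  intro z hz
  contrapose! hz
  simp only [Function.mem_support, not_not] at hz ⊢
  simp [dbarC, hz]

lemma dbarC_integrable {φ : ℂ → ℂ} (h : ContDiff ℝ 1 φ) (hs : HasCompactSupport φ) (a : ℂ) :
    Integrable (fun z => dbarC φ z * (z - a)⁻¹) := by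
  obtain ⟨C, hC⟩ := (dbarC_cont h).bounded_above_of_compact_support (dbarC_supp hs)
  obtain ⟨r, hr⟩ := (dbarC_supp hs).isCompact.isBounded.subset_ball a
  have h1 : IntegrableOn (fun z => dbarC φ z * (z - a)⁻¹) (Metric.ball a r) := by
    refine Integrable.bdd_mul (integrableOn_inv_ball r a)
      (dbarC_cont h).aestronglyMeasurable (c := C) (ae_of_all _ hC)
  refine (integrableOn_iff_integrable_of_support_subset ?_).1 h1
  intro z hz
  refine hr (subset_tsupport _ ?_)
  intro h0
  simp [h0] at hz

lemma pompeiu0_s10 {φ : ℂ → ℂ} (h : ContDiff ℝ 1 φ) (hs : HasCompactSupport φ) :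
    ∫ z, dbarC φ z * z⁻¹ = - Real.pi * φ 0 := by
  set E : ℝ → ℂ := fun θ => Complex.exp (θ * Complex.I) with hE
  have hEc : Continuous E := by fun_prop
  have hEn : ∀ θ, ‖E θ‖ = 1 := fun θ => Complex.norm_exp_ofReal_mul_I θ
  have hE0 : ∀ θ, E θ ≠ 0 := fun θ => Complex.exp_ne_zero _
  set F1 : ℝ × ℝ → ℂ := fun p => fderiv ℝ φ (p.1 * E p.2) (E p.2) with hF1
  set F2 : ℝ × ℝ → ℂ := fun p => fderiv ℝ φ (p.1 * E p.2) (Complex.I * E p.2) with hF2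
  have hfc := h.continuous_fderiv one_ne_zero
  have c1 : Continuous F1 := by
    refine Continuous.clm_apply (hfc.comp ?_) ?_ <;> fun_prop
  have c2 : Continuous F2 := by
    refine Continuous.clm_apply (hfc.comp ?_) ?_ <;> fun_prop
  obtain ⟨ρ, hρ⟩ := (hs.fderiv (𝕜 := ℝ)).isCompact.isBounded.subset_ball 0
  have hz : ∀ p : ℝ × ℝ, ρ ≤ p.1 → fderiv ℝ φ (p.1 * E p.2) = 0 := by
    intro p hp
    by_contra hne
    have := hρ (subset_tsupport _ hne)
    rw [mem_ball_zero_iff, norm_mul, hEn, mul_one, Complex.norm_real, Real.norm_eq_abs] at this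
    linarith [le_abs_self p.1]
  have hint : ∀ F : ℝ × ℝ → ℂ, Continuous F → (∀ p, ρ ≤ p.1 → F p = 0) →
      IntegrableOn F (Ioi 0 ×ˢ Ioo (-Real.pi) Real.pi) := by
    intro F hF hF0
    have : IntegrableOn F (Icc 0 ρ ×ˢ Icc (-Real.pi) Real.pi) :=
      hF.continuousOn.integrableOn_compact (isCompact_Icc.prod isCompact_Icc)
    refine this.of_forall_sdiff_eq_zero (measurableSet_Ioi.prod measurableSet_Ioo) ?_
    rintro ⟨s, θ⟩ ⟨hp, hq⟩
    apply hF0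
    by_contra hlt
    simp only [mem_prod, mem_Ioi, mem_Ioo, mem_Icc] at hp hq
    exact hq ⟨⟨hp.1.le, by simpa using (not_le.1 hlt).le⟩, hp.2.1.le, hp.2.2.le⟩
  have i1 := hint F1 c1 (fun p hp => by simp [hF1, hz p hp])
  have i2 := hint F2 c2 (fun p hp => by simp [hF2, hz p hp])
  have hd := h.differentiable one_ne_zero
  have key : ∀ p ∈ polarCoord.target,
      p.1 • (dbarC φ (Complex.polarCoord.symm p) * (Complex.polarCoord.symm p)⁻¹)
        = (1/2 : ℂ) * F1 p + (Complex.I / 2) * F2 p := by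
    rintro ⟨s, θ⟩ hp
    simp only [polarCoord_target, mem_prod, mem_Ioi] at hp
    have hs0 : (s : ℂ) ≠ 0 := by exact_mod_cast hp.1.ne'
    have hpe : Complex.polarCoord.symm (s, θ) = s * E θ := by
      rw [Complex.polarCoord_symm_apply, hE]
      simp [Complex.exp_mul_I]
    rw [hpe]
    simp only [hF1, hF2, dbarC]
    set L := fderiv ℝ φ (s * E θ)
    set x := Real.cos θ
    set y := Real.sin θ
    have hxy : ((x:ℂ))^2 + (y:ℂ)^2 = 1 := by exact_mod_cast Real.cos_sq_add_sin_sq θ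
    have e1 : E θ = x + y * Complex.I := by simp [hE, Complex.exp_mul_I, x, y]
    have e2 : E θ = x • (1:ℂ) + y • Complex.I := by rw [e1]; simp
    have e3 : Complex.I * E θ = x • Complex.I - y • (1:ℂ) := by
      rw [e1]; simp; linear_combination (y:ℂ) * Complex.I_sq
    have e4 : (E θ)⁻¹ = x - y * Complex.I := by
      rw [inv_eq_iff_eq_inv, eq_comm, inv_eq_iff_eq_inv, ← mul_eq_one_iff_eq_inv₀ (hE0 θ), e1]
      linear_combination hxy - (y:ℂ)^2 * Complex.I_sq
    rw [mul_inv, e3]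
    conv_rhs => rw [e2]
    rw [e4]
    simp only [map_add, map_sub, map_smul]
    simp only [Complex.real_smul]
    field_simp
    linear_combination (- y * (L Complex.I)) * Complex.I_sq
  have v1 : ∫ p in Ioi 0 ×ˢ Ioo (-Real.pi) Real.pi, F1 p = -(2 * Real.pi) * φ 0 := by
    rw [Measure.volume_eq_prod, ← Measure.prod_restrict, integral_prod_symm]
    swap
    · rw [Measure.prod_restrict, ← Measure.volume_eq_prod]; exact i1
    have : ∀ θ : ℝ, ∫ r in Ioi (0:ℝ), F1 (r, θ) = - φ 0 := by
      intro θ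
      have hcl : HasCompactSupport (fun r : ℝ => φ (r * E θ)) := by
        obtain ⟨ρ', hρ'⟩ := hs.isCompact.isBounded.subset_ball 0
        refine HasCompactSupport.of_support_subset_isCompact (isCompact_Icc (a := -ρ') (b := ρ')) ?_
        intro r hr
        have := hρ' (subset_tsupport _ hr)
        rw [mem_ball_zero_iff, norm_mul, hEn, mul_one, Complex.norm_real, Real.norm_eq_abs] at this
        exact abs_le.1 this.le
      have hder : ∀ r : ℝ, HasDerivAt (fun r : ℝ => φ (r * E θ)) (F1 (r, θ)) r := by
        intro r
        have h1 : HasDerivAt (fun r : ℝ => (r:ℂ) * E θ) (E θ) r := by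
          simpa using (Complex.ofRealCLM.hasDerivAt (x := r)).mul_const (E θ)
        exact (hd _).hasFDerivAt.comp_hasDerivAt r h1
      have := HasCompactSupport.integral_Ioi_deriv_eq (f := fun r : ℝ => φ (r * E θ))
        (h.comp (Complex.ofRealCLM.contDiff.mul contDiff_const)) hcl 0
      rw [show deriv (fun r : ℝ => φ (r * E θ)) = fun r => F1 (r, θ) from
        funext fun r => (hder r).deriv] at this
      simpa using this
    simp_rw [this]
    rw [setIntegral_const, Measure.real, Real.volume_Ioo,
      ENNReal.toReal_ofReal (by linarith [Real.pi_pos]), Complex.real_smul]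
    push_cast
    ring
  have v2 : ∫ p in Ioi 0 ×ˢ Ioo (-Real.pi) Real.pi, F2 p = 0 := by
    rw [Measure.volume_eq_prod, setIntegral_prod _ i2]
    refine setIntegral_eq_zero_of_forall_eq_zero ?_
    intro r hr
    have hr0 : (r:ℂ) ≠ 0 := by exact_mod_cast (ne_of_gt hr)
    have hder : ∀ θ : ℝ, HasDerivAt (fun θ : ℝ => φ (r * E θ)) (r * F2 (r, θ)) θ := by
      intro θ
      have h0 : HasDerivAt E (Complex.I * E θ) θ := by
        have := ((Complex.ofRealCLM.hasDerivAt (x := θ)).mul_const Complex.I).cexp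
        simpa [hE, mul_comm] using this
      have h1 := h0.const_mul (r:ℂ)
      have := (hd _).hasFDerivAt.comp_hasDerivAt θ h1
      have heq : (r:ℂ) * F2 (r, θ) = fderiv ℝ φ (r * E θ) (r * (Complex.I * E θ)) := by
        rw [← Complex.real_smul (x := r) (z := Complex.I * E θ), map_smul, Complex.real_smul]
      rw [heq]
      exact this
    have := intervalIntegral.integral_eq_sub_of_hasDerivAt (a := -Real.pi) (b := Real.pi)
      (fun θ _ => hder θ) (by
        apply Continuous.intervalIntegrable; fun_prop)
    have hEE : E Real.pi = E (-Real.pi) := by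
      simp [hE, Complex.exp_neg]
    rw [hEE, sub_self, intervalIntegral.integral_of_le (by linarith [Real.pi_pos]),
      integral_Ioc_eq_integral_Ioo, integral_const_mul] at this
    exact (mul_eq_zero.1 this).resolve_left hr0
  rw [← Complex.integral_comp_polarCoord_symm,
    setIntegral_congr_fun polarCoord.open_target.measurableSet key, polarCoord_target,
    integral_add (i1.const_mul _) (i2.const_mul _), integral_const_mul, integral_const_mul, v1, v2]
  ring

lemma pompeiu_s10 {φ : ℂ → ℂ} (h : ContDiff ℝ 1 φ) (hs : HasCompactSupport φ) (a : ℂ) :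
    ∫ z, dbarC φ z * (z - a)⁻¹ = - Real.pi * φ a := by
  have := pompeiu0_s10 (φ := fun z => φ (z + a)) (h.comp (by fun_prop))
    (hs.comp_homeomorph (Homeomorph.addRight a))
  rw [← integral_add_right_eq_self _ a]
  simp only [add_sub_cancel_right]
  rw [zero_add] at this
  rw [← this]
  congr 1
  ext z
  simp only [dbarC]
  rw [fderiv_comp_add_right]

noncomputable def PL (L : List ℂ) (z : ℂ) : ℂ := (L.map (fun a => z - a)).prod

lemma PL_cons (a : ℂ) (L : List ℂ) (z : ℂ) : PL (a :: L) z = (z - a) * PL L z := by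
  simp [PL]

lemma PL_cont (L : List ℂ) : Continuous (PL L) := by
  induction L with
  | nil =>
    have : PL [] = fun _ => 1 := funext fun z => by simp [PL]
    rw [this]; fun_prop
  | cons a L ih =>
    have : PL (a :: L) = fun z => (z - a) * PL L z := funext fun z => PL_cons a L z
    rw [this]; fun_prop

lemma PL_ne {L : List ℂ} {z : ℂ} (h : z ∉ L) : PL L z ≠ 0 := by
  induction L with
  | nil => simp [PL]
  | cons a L ih =>
    simp only [List.mem_cons, not_or] at h
    rw [PL_cons]
    exact mul_ne_zero (sub_ne_zero.2 h.1) (ih h.2)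

lemma PL_le {L : List ℂ} {z : ℂ} {r : ℝ} (h : ∀ a ∈ L, ‖z - a‖ ≤ r) (hr : 0 ≤ r) :
    ‖PL L z‖ ≤ r ^ L.length := by
  induction L with
  | nil => simp [PL]
  | cons a L ih =>
    simp only [List.mem_cons, forall_eq_or_imp] at h
    rw [PL_cons, norm_mul, List.length_cons, pow_succ']
    exact mul_le_mul h.1 (ih h.2) (norm_nonneg _) hr

lemma PL_ge {L : List ℂ} {z : ℂ} {r : ℝ} (h : ∀ a ∈ L, r ≤ ‖z - a‖) (hr : 0 ≤ r) :
    r ^ L.length ≤ ‖PL L z‖ := by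
  induction L with
  | nil => simp [PL]
  | cons a L ih =>
    simp only [List.mem_cons, forall_eq_or_imp] at h
    rw [PL_cons, norm_mul, List.length_cons, pow_succ']
    exact mul_le_mul h.1 (ih h.2) (by positivity) (norm_nonneg _)

lemma ae_notMem_list (μ : Measure ℂ) [NullSingletonClass μ] (L : List ℂ) : ∀ᵐ z ∂μ, z ∉ L := by
  have : μ {z | z ∈ L} = 0 := (L.finite_toSet).measure_zero μ
  exact measure_eq_zero_iff_ae_notMem.1 this

lemma split_ker {a ζ z p : ℂ} (hza : z ≠ a) (hzζ : z ≠ ζ) (haζ : a ≠ ζ) (hp : p ≠ 0) :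
    ((z - a) * p * (z - ζ))⁻¹ = (a - ζ)⁻¹ * ((p * (z - a))⁻¹ - (p * (z - ζ))⁻¹) := by
  have := sub_ne_zero.2 hza
  have := sub_ne_zero.2 hzζ
  have := sub_ne_zero.2 haζ
  field_simp
  ring

lemma ker_int (L : List ℂ) (hL : L.Nodup) (c : ℂ) (r : ℝ) : ∀ ζ ∉ L,
    IntegrableOn (fun z => (PL L z * (z - ζ))⁻¹) (Metric.ball c r) := by
  induction L with
  | nil =>
    intro ζ _
    simp only [PL, List.map_nil, List.prod_nil, one_mul]
    exact (integrableOn_inv_ball (r + dist c ζ) ζ).mono_set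
      (Metric.ball_subset_ball' le_rfl)
  | cons a L ih =>
    intro ζ hζ
    rw [List.nodup_cons] at hL
    simp only [List.mem_cons, not_or] at hζ
    have h1 := ((ih hL.2 a hL.1).sub (ih hL.2 ζ hζ.2)).const_mul (a - ζ)⁻¹
    refine h1.congr ?_
    filter_upwards [ae_notMem_list _ (ζ :: a :: L)] with z hz
    simp only [List.mem_cons, not_or] at hz
    rw [PL_cons, split_ker hz.2.1 hz.1 (Ne.symm hζ.1) (PL_ne hz.2.2)]
    rfl

lemma ker_int' (L : List ℂ) (hL : L.Nodup) (c : ℂ) (r : ℝ) :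
    IntegrableOn (fun z => (PL L z)⁻¹) (Metric.ball c r) := by
  cases L with
  | nil =>
    simp only [PL, List.map_nil, List.prod_nil]
    exact integrableOn_const measure_ball_lt_top.ne
  | cons a L =>
    rw [List.nodup_cons] at hL
    simpa only [PL_cons, mul_comm] using ker_int L hL.2 c r a hL.1

lemma pompeiuL {φ : ℂ → ℂ} (h : ContDiff ℝ 1 φ) (hs : HasCompactSupport φ)
    (L : List ℂ) (hL : L.Nodup) (h0 : ∀ a ∈ L, φ a = 0) : ∀ ζ ∉ L,
    Integrable (fun z => dbarC φ z * (PL L z * (z - ζ))⁻¹) ∧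
    ∫ z, dbarC φ z * (PL L z * (z - ζ))⁻¹ = - Real.pi * (φ ζ / PL L ζ) := by
  induction L with
  | nil =>
    intro ζ _
    simp only [PL, List.map_nil, List.prod_nil, one_mul, div_one]
    exact ⟨dbarC_integrable h hs ζ, pompeiu_s10 h hs ζ⟩
  | cons a L ih =>
    intro ζ hζ
    rw [List.nodup_cons] at hL
    simp only [List.mem_cons, forall_eq_or_imp] at h0
    simp only [List.mem_cons, not_or] at hζ
    obtain ⟨i1, v1⟩ := ih hL.2 h0.2 a hL.1
    obtain ⟨i2, v2⟩ := ih hL.2 h0.2 ζ hζ.2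
    have hae : (fun z => (a - ζ)⁻¹ * (dbarC φ z * (PL L z * (z - a))⁻¹
        - dbarC φ z * (PL L z * (z - ζ))⁻¹)) =ᵐ[volume]
        fun z => dbarC φ z * (PL (a :: L) z * (z - ζ))⁻¹ := by
      filter_upwards [ae_notMem_list _ (ζ :: a :: L)] with z hz
      simp only [List.mem_cons, not_or] at hz
      rw [PL_cons, split_ker hz.2.1 hz.1 (Ne.symm hζ.1) (PL_ne hz.2.2)]
      ring
    refine ⟨((i1.sub i2).const_mul _).congr hae, ?_⟩
    rw [← integral_congr_ae hae, integral_const_mul, integral_sub i1 i2, v1, v2, h0.1, PL_cons]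
    have h3 := sub_ne_zero.2 hζ.1
    have h4 := sub_ne_zero.2 (Ne.symm hζ.1)
    have h5 := PL_ne hζ.2
    field_simp
    ring

lemma lint_bound (z₀ z : ℂ) (R : ℝ) (hR : 0 < R) (hz : z ∈ Metric.ball z₀ R) :
    ∫⁻ ζ in Metric.ball z₀ R, ‖(z - ζ)⁻¹‖ₑ ≤ ENNReal.ofReal (4 * Real.pi * R) := by
  have h1 := lint_inv_ball (2 * R) (by linarith) z
  calc _ ≤ ∫⁻ ζ in Metric.ball z (2 * R), ‖(z - ζ)⁻¹‖ₑ := by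
        apply lintegral_mono_set
        apply Metric.ball_subset_ball'
        rw [Metric.mem_ball, dist_comm] at hz
        linarith
    _ = ∫⁻ ζ in Metric.ball z (2 * R), ‖(ζ - z)⁻¹‖ₑ := by
        congr 1; ext ζ
        rw [← neg_sub, inv_neg, enorm_neg]
    _ ≤ _ := by
        refine h1.trans (le_of_eq ?_)
        congr 1; ring

lemma carl {φ : ℂ → ℂ} (h : ContDiff ℝ 1 φ) (hs : HasCompactSupport φ)
    (z₀ : ℂ) (R M N : ℝ) (hR : 0 < R) (hM : 0 ≤ M) (hN : 0 ≤ N) (hRM : 4 * R * M ≤ 1 / 2)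
    (hsup : ∀ z ∉ Metric.ball z₀ R, dbarC φ z = 0)
    (hb1 : ∀ z ∈ Metric.ball z₀ (R / 2), ‖dbarC φ z‖ ≤ M * ‖φ z‖)
    (hb2 : ∀ z, ‖dbarC φ z‖ ≤ M * ‖φ z‖ + N)
    (L : List ℂ) (hL : L.Nodup) (h0 : ∀ a ∈ L, φ a = 0)
    (hLb : ∀ a ∈ L, a ∈ Metric.ball z₀ (R / 8)) :
    ∫⁻ z in Metric.ball z₀ (R / 8), ‖φ z‖ₑ ≤
      ENNReal.ofReal (8 * R * N * (volume (Metric.ball z₀ R)).toReal * (2 / 3) ^ L.length) := by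
  set B := Metric.ball z₀ R with hB
  have hBm : MeasurableSet B := Metric.isOpen_ball.measurableSet
  have hV : volume B ≠ ⊤ := measure_ball_lt_top.ne
  set n := L.length
  set X := ∫⁻ ζ in B, ‖φ ζ / PL L ζ‖ₑ with hX
  have hφc := h.continuous
  have hPc := PL_cont L
  have hdc := dbarC_cont h
  have hXfin : X ≠ ⊤ := by
    obtain ⟨C, hC⟩ := hφc.bounded_above_of_compact_support hs
    have := Integrable.bdd_mul (ker_int' L hL z₀ R) hφc.aestronglyMeasurable (c := C)
      (ae_of_all _ hC)
    exact this.2.ne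
  set W : ℂ → ENNReal := fun z => ‖dbarC φ z‖ₑ * ‖(PL L z)⁻¹‖ₑ with hW
  have hWm : Measurable W := by
    refine Measurable.mul (f := fun z => ‖dbarC φ z‖ₑ) (g := fun z => ‖(PL L z)⁻¹‖ₑ) ?_ ?_ <;> apply Measurable.enorm
    · exact hdc.measurable
    · exact hPc.measurable.inv
  -- pointwise
  have pw : ∀ ζ ∉ L, ENNReal.ofReal Real.pi * ‖φ ζ / PL L ζ‖ₑ ≤
      ∫⁻ z in B, W z * ‖(z - ζ)⁻¹‖ₑ := by
    intro ζ hζ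
    obtain ⟨_, hv⟩ := pompeiuL h hs L hL h0 ζ hζ
    have e1 : ENNReal.ofReal Real.pi * ‖φ ζ / PL L ζ‖ₑ
        = ‖∫ z, dbarC φ z * (PL L z * (z - ζ))⁻¹‖ₑ := by
      rw [hv, enorm_mul, enorm_neg, ← ofReal_norm (Real.pi : ℂ), Complex.norm_real,
        Real.norm_of_nonneg Real.pi_pos.le]
    rw [e1]
    refine (enorm_integral_le_lintegral_enorm _).trans ?_
    rw [← lintegral_indicator hBm]
    refine lintegral_mono fun z => ?_
    by_cases hz : z ∈ B
    · rw [indicator_of_mem hz, hW, mul_inv, enorm_mul, enorm_mul, mul_assoc]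
    · simp [hsup z hz]
  have s1 : ENNReal.ofReal Real.pi * X ≤ ENNReal.ofReal (4 * Real.pi * R) * ∫⁻ z in B, W z := by
    calc _ = ∫⁻ ζ in B, ENNReal.ofReal Real.pi * ‖φ ζ / PL L ζ‖ₑ := by
          rw [lintegral_const_mul' _ _ ENNReal.ofReal_ne_top]
      _ ≤ ∫⁻ ζ in B, ∫⁻ z in B, W z * ‖(z - ζ)⁻¹‖ₑ := by
          refine lintegral_mono_ae ?_
          filter_upwards [ae_notMem_list _ L] with ζ hζ using pw ζ hζ
      _ = ∫⁻ z in B, ∫⁻ ζ in B, W z * ‖(z - ζ)⁻¹‖ₑ := by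
          refine lintegral_lintegral_swap ?_
          apply Measurable.aemeasurable
          refine Measurable.mul (f := fun p : ℂ × ℂ => W p.2) (g := fun p => ‖(p.2 - p.1)⁻¹‖ₑ) ?_ ?_
          · exact hWm.comp measurable_snd
          · apply Measurable.enorm
            apply Measurable.inv
            exact measurable_snd.sub measurable_fst
      _ ≤ ∫⁻ z in B, ENNReal.ofReal (4 * Real.pi * R) * W z := by
          refine setLIntegral_mono' hBm fun z hz => ?_
          rw [lintegral_const_mul, mul_comm]
          · gcongr
            exact lint_bound z₀ z R hR hz
          · exact (measurable_const.sub measurable_id).inv.enorm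
      _ = _ := by rw [lintegral_const_mul' _ _ ENNReal.ofReal_ne_top]
  have hr3 : (0:ℝ) < 3 * R / 8 := by linarith
  have s2 : ∀ z, W z ≤ ENNReal.ofReal M * ‖φ z / PL L z‖ₑ
      + ENNReal.ofReal (N * ((3 * R / 8) ^ n)⁻¹) := by
    intro z
    rw [hW]
    simp only [← ofReal_norm]
    rw [← ENNReal.ofReal_mul (norm_nonneg _), ← ENNReal.ofReal_mul hM,
      ← ENNReal.ofReal_add (by positivity) (by positivity)]
    apply ENNReal.ofReal_le_ofReal
    rw [norm_div, norm_inv, ← div_eq_mul_inv]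
    by_cases hz : z ∈ Metric.ball z₀ (R / 2)
    · have := hb1 z hz
      have h2 : ‖dbarC φ z‖ / ‖PL L z‖ ≤ M * ‖φ z‖ / ‖PL L z‖ := by gcongr
      have h3 : 0 ≤ N * ((3 * R / 8) ^ n)⁻¹ := by positivity
      rw [← mul_div_assoc]; linarith
    · have hge : (3 * R / 8) ^ n ≤ ‖PL L z‖ := by
        apply PL_ge _ hr3.le
        intro a ha
        have h1 := hLb a ha
        rw [Metric.mem_ball] at h1 hz
        have := dist_triangle z a z₀
        rw [← dist_eq_norm]; linarith
      calc _ ≤ (M * ‖φ z‖ + N) / ‖PL L z‖ := by gcongr; exact hb2 z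
        _ = M * (‖φ z‖ / ‖PL L z‖) + N * (‖PL L z‖)⁻¹ := by ring
        _ ≤ _ := by gcongr
  have s3 : ∫⁻ z in B, W z ≤ ENNReal.ofReal M * X
      + ENNReal.ofReal (N * ((3 * R / 8) ^ n)⁻¹) * volume B := by
    calc _ ≤ ∫⁻ z in B, (ENNReal.ofReal M * ‖φ z / PL L z‖ₑ
          + ENNReal.ofReal (N * ((3 * R / 8) ^ n)⁻¹)) := lintegral_mono s2
      _ = _ := by
        rw [lintegral_add_right _ measurable_const, lintegral_const_mul' _ _ ENNReal.ofReal_ne_top,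
          setLIntegral_const]
  have s4 : X.toReal ≤ 8 * R * (N * ((3 * R / 8) ^ n)⁻¹ * (volume B).toReal) := by
    have s5 := s1.trans (mul_le_mul_right s3 _)
    set x := X.toReal with hx
    set V := (volume B).toReal with hVd
    have hx0 : 0 ≤ x := ENNReal.toReal_nonneg
    have hV0 : 0 ≤ V := ENNReal.toReal_nonneg
    have eX : X = ENNReal.ofReal x := (ENNReal.ofReal_toReal hXfin).symm
    have eV : volume B = ENNReal.ofReal V := (ENNReal.ofReal_toReal hV).symm
    have hpi := Real.pi_pos
    set t := N * ((3 * R / 8) ^ n)⁻¹ with ht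
    have ht0 : 0 ≤ t := by positivity
    rw [eX, eV, ← ENNReal.ofReal_mul hpi.le, ← ENNReal.ofReal_mul hM, ← ENNReal.ofReal_mul ht0,
      ← ENNReal.ofReal_add (by positivity) (by positivity), ← ENNReal.ofReal_mul (by positivity),
      ENNReal.ofReal_le_ofReal_iff (by positivity)] at s5
    have s6 : x ≤ 4 * R * (M * x + t * V) := by
      refine le_of_mul_le_mul_left ?_ hpi
      linarith
    have s7 : 4 * R * M * x ≤ 1 / 2 * x := by gcongr
    linarith
  have s8 : ∫⁻ z in Metric.ball z₀ (R / 8), ‖φ z‖ₑ ≤ ENNReal.ofReal ((R / 4) ^ n) * X := by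
    calc _ ≤ ∫⁻ z in Metric.ball z₀ (R / 8), ENNReal.ofReal ((R / 4) ^ n) * ‖φ z / PL L z‖ₑ := by
          refine lintegral_mono_ae ?_
          filter_upwards [ae_notMem_list _ L, ae_restrict_mem Metric.isOpen_ball.measurableSet]
            with z hz hzb
          simp only [← ofReal_norm]
          rw [← ENNReal.ofReal_mul (by positivity)]
          apply ENNReal.ofReal_le_ofReal
          have hle : ‖PL L z‖ ≤ (R / 4) ^ n := by
            apply PL_le _ (by linarith)
            intro a ha
            have h1 := hLb a ha
            rw [Metric.mem_ball] at h1 hzb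
            have := dist_triangle_right z a z₀
            rw [← dist_eq_norm]; linarith
          have hp : 0 < ‖PL L z‖ := norm_pos_iff.2 (PL_ne hz)
          calc ‖φ z‖ = ‖PL L z‖ * ‖φ z / PL L z‖ := by rw [norm_div]; field_simp
            _ ≤ _ := by gcongr
      _ ≤ ∫⁻ z in B, ENNReal.ofReal ((R / 4) ^ n) * ‖φ z / PL L z‖ₑ :=
          lintegral_mono_set (Metric.ball_subset_ball (by linarith))
      _ = _ := by rw [lintegral_const_mul' _ _ ENNReal.ofReal_ne_top]
  refine s8.trans ?_
  rw [← ENNReal.ofReal_toReal hXfin, ← ENNReal.ofReal_mul (by positivity)]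
  apply ENNReal.ofReal_le_ofReal
  calc _ ≤ (R / 4) ^ n * (8 * R * (N * ((3 * R / 8) ^ n)⁻¹ * (volume B).toReal)) := by gcongr
    _ = 8 * R * N * (volume B).toReal * ((R / 4) ^ n * ((3 * R / 8) ^ n)⁻¹) := by ring
    _ = _ := by
      rw [← inv_pow, ← mul_pow]
      congr 2
      field_simp
      norm_num

lemma carl_zero {φ : ℂ → ℂ} (h : ContDiff ℝ 1 φ) (hs : HasCompactSupport φ)
    (z₀ : ℂ) (R M N : ℝ) (hR : 0 < R) (hM : 0 ≤ M) (hN : 0 ≤ N) (hRM : 4 * R * M ≤ 1 / 2)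
    (hsup : ∀ z ∉ Metric.ball z₀ R, dbarC φ z = 0)
    (hb1 : ∀ z ∈ Metric.ball z₀ (R / 2), ‖dbarC φ z‖ ≤ M * ‖φ z‖)
    (hb2 : ∀ z, ‖dbarC φ z‖ ≤ M * ‖φ z‖ + N)
    (hinf : {z ∈ Metric.ball z₀ (R / 8) | φ z = 0}.Infinite) :
    ∀ z ∈ Metric.ball z₀ (R / 8), φ z = 0 := by
  have hle : ∀ n : ℕ, ∫⁻ z in Metric.ball z₀ (R / 8), ‖φ z‖ₑ ≤
      ENNReal.ofReal (8 * R * N * (volume (Metric.ball z₀ R)).toReal * (2 / 3) ^ n) := by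
    intro n
    obtain ⟨t, ht, hn⟩ := hinf.exists_subset_card_eq n
    have := carl h hs z₀ R M N hR hM hN hRM hsup hb1 hb2 t.toList t.nodup_toList
      (fun a ha => (ht (by simpa using ha)).2) (fun a ha => (ht (by simpa using ha)).1)
    rwa [Finset.length_toList, hn] at this
  have hlim : Tendsto (fun n : ℕ =>
      ENNReal.ofReal (8 * R * N * (volume (Metric.ball z₀ R)).toReal * (2 / 3) ^ n)) atTop (𝓝 0) := by
    rw [← ENNReal.ofReal_zero]
    refine ENNReal.tendsto_ofReal ?_
    have := (tendsto_pow_atTop_nhds_zero_of_lt_one (r := (2/3:ℝ)) (by norm_num)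
      (by norm_num)).const_mul (8 * R * N * (volume (Metric.ball z₀ R)).toReal)
    simpa using this
  have hzero : ∫⁻ z in Metric.ball z₀ (R / 8), ‖φ z‖ₑ = 0 :=
    le_antisymm (ge_of_tendsto' hlim hle) zero_le
  rw [lintegral_eq_zero_iff h.continuous.measurable.enorm] at hzero
  have hae : φ =ᵐ[volume.restrict (Metric.ball z₀ (R / 8))] fun _ => 0 := by
    filter_upwards [hzero] with z hz using by simpa using hz
  exact Measure.eqOn_open_of_ae_eq hae Metric.isOpen_ball h.continuous.continuousOn
    continuousOn_const

lemma dbarC_congr {φ ψ : ℂ → ℂ} {z : ℂ} (h : φ =ᶠ[𝓝 z] ψ) : dbarC φ z = dbarC ψ z := by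
  simp only [dbarC, h.fderiv_eq]

lemma local_ucp {Q : ℂ → ℂ} {z₀ : ℂ} {r M : ℝ} (hr : 0 < r) (hM : 0 ≤ M)
    (hQ : ∀ z ∈ Metric.ball z₀ r, ContDiffAt ℝ 1 Q z)
    (hb : ∀ z ∈ Metric.ball z₀ r, ‖dbarC Q z‖ ≤ M * ‖Q z‖)
    (hfr : ∃ᶠ z in 𝓝[≠] z₀, Q z = 0) : ∀ᶠ z in 𝓝 z₀, Q z = 0 := by
  obtain ⟨R, hR, hRr, hRM⟩ : ∃ R, 0 < R ∧ R ≤ r ∧ 4 * R * M ≤ 1 / 2 := by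
    refine ⟨min r (1 / (8 * (M + 1))), lt_min hr (by positivity), min_le_left _ _, ?_⟩
    have h1 := min_le_right r (1 / (8 * (M + 1)))
    set R := min r (1 / (8 * (M + 1)))
    rw [le_div_iff₀ (by positivity)] at h1
    have : 0 < R := lt_min hr (by positivity)
    nlinarith
  let χ : ContDiffBump z₀ := ⟨R / 2, 3 * R / 4, by linarith, by linarith⟩
  set φ : ℂ → ℂ := fun z => (χ z) • Q z with hφ
  have hout : ∀ z, z ∉ Metric.closedBall z₀ (3 * R / 4) → φ =ᶠ[𝓝 z] fun _ => 0 := by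
    intro z hz
    filter_upwards [Metric.isClosed_closedBall.isOpen_compl.mem_nhds hz] with w hw
    have : χ w = 0 := by
      apply χ.zero_of_le_dist
      simp only [mem_compl_iff, Metric.mem_closedBall, not_le] at hw
      exact hw.le
    simp [hφ, this]
  have hin : ∀ z ∈ Metric.ball z₀ (R / 2), φ =ᶠ[𝓝 z] Q := by
    intro z hz
    filter_upwards [Metric.isOpen_ball.mem_nhds hz] with w hw
    have : χ w = 1 := χ.one_of_mem_closedBall (Metric.ball_subset_closedBall hw)
    simp [hφ, this]
  have hsub : ∀ z, z ∉ Metric.ball z₀ R → z ∉ Metric.closedBall z₀ (3 * R / 4) := by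
    intro z hz hz'
    exact hz (Metric.closedBall_subset_ball (by linarith) hz')
  have hφd : ContDiff ℝ 1 φ := by
    rw [contDiff_iff_contDiffAt]
    intro z
    by_cases hz : z ∈ Metric.ball z₀ R
    · exact χ.contDiffAt.smul (hQ z (Metric.ball_subset_ball hRr hz))
    · exact contDiffAt_const.congr_of_eventuallyEq (hout z (hsub z hz))
  have hφs : HasCompactSupport φ := χ.hasCompactSupport.smul_right
  obtain ⟨N, hN⟩ := (dbarC_cont hφd).bounded_above_of_compact_support (dbarC_supp hφs)
  have hN0 : 0 ≤ N := (norm_nonneg _).trans (hN 0)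
  have key := carl_zero hφd hφs z₀ R M N hR hM hN0 hRM
    (by
      intro z hz
      rw [dbarC_congr (hout z (hsub z hz))]
      simp [dbarC])
    (by
      intro z hz
      rw [dbarC_congr (hin z hz), (hin z hz).eq_of_nhds]
      exact hb z (Metric.ball_subset_ball (by linarith) hz))
    (by
      intro z
      have := hN z
      have : 0 ≤ M * ‖φ z‖ := by positivity
      linarith [hN z])
    (by
      intro hfin
      have h1 := (hfin.subset (sdiff_subset (t := {z₀}))).isClosed.isOpen_compl.mem_nhds
        (x := z₀) (by simp)
      have h2 : ∀ᶠ z in 𝓝[≠] z₀, Q z ≠ 0 := by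
        rw [eventually_nhdsWithin_iff]
        filter_upwards [h1, Metric.ball_mem_nhds z₀ (show 0 < R / 8 by linarith)] with z hz hzb hne h0
        apply hz
        refine ⟨⟨hzb, ?_⟩, hne⟩
        simp [hφ, h0]
      exact hfr h2)
  filter_upwards [Metric.ball_mem_nhds z₀ (show 0 < R / 8 by linarith)] with z hz
  rw [← (hin z (Metric.ball_subset_ball (by linarith) hz)).eq_of_nhds]
  exact key z hz

lemma bound_alg {s a f a' f' l l' c s' q : ℝ} (hs : 0 < s) (hl : 0 < l)
    (h1 : s ^ 2 - a ^ 2 - 4 * f ^ 2 = 16 * c * l ^ 2)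
    (h2 : s * s' = a * a' + 4 * f * f' + 16 * c * l * l')
    (hq : 0 ≤ q) (hq2 : a ^ 2 + 4 * f ^ 2 = 16 * q ^ 2) :
    |s' - s * l' / l| ≤ q * ((4 * |a'| + 8 * |f'| + 16 * q * |l'| / l) / s) := by
  have ha : |a| ≤ 4 * q := by
    apply abs_le_of_sq_le_sq _ (by positivity); nlinarith [sq_nonneg f]
  have hf : |f| ≤ 2 * q := by
    apply abs_le_of_sq_le_sq _ (by positivity); nlinarith [sq_nonneg a]
  have e1 : s * (s' - s * l' / l) = a * a' + 4 * f * f' - 16 * q ^ 2 * l' / l := by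
    field_simp
    linear_combination l * h2 - l' * h1 - l' * hq2
  have e2 : |s * (s' - s * l' / l)| ≤ 4 * q * |a'| + 8 * q * |f'| + 16 * q ^ 2 * |l'| / l := by
    rw [e1]
    calc _ ≤ |a * a'| + |4 * f * f'| + |16 * q ^ 2 * l' / l| := by
          refine (abs_sub _ _).trans ?_
          gcongr
          exact abs_add_le _ _
      _ = |a| * |a'| + 4 * |f| * |f'| + 16 * q ^ 2 * |l'| / l := by
          simp only [abs_mul, abs_div, abs_of_pos hl, abs_of_nonneg (sq_nonneg q)]
          norm_num
      _ ≤ _ := by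
          have := mul_le_mul_of_nonneg_right ha (abs_nonneg a')
          have := mul_le_mul_of_nonneg_right hf (abs_nonneg f')
          linarith
  rw [abs_mul, abs_of_pos hs] at e2
  rw [← mul_div_assoc, le_div_iff₀ hs]
  calc _ = s * |s' - s * l' / l| := by ring
    _ ≤ _ := e2
    _ = _ := by ring

theorem constant_extrinsic_umbilic_isolated
    (U : Set ℂ) (hUopen : IsOpen U) (hUconn : IsConnected U)
    (lam e f g : ℂ → ℝ)
    (hlam : ContDiffOn ℝ 1 lam U) (he : ContDiffOn ℝ 1 e U)
    (hf : ContDiffOn ℝ 1 f U) (hg : ContDiffOn ℝ 1 g U)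
    (hpos : ∀ z ∈ U, 0 < lam z)
    (hcod1 : ∀ z ∈ U, pv e z - pu f z = (e z + g z) * pv lam z / (2 * lam z))
    (hcod2 : ∀ z ∈ U, pv f z - pu g z = -((e z + g z) * pu lam z / (2 * lam z)))
    (H Ke : ℂ → ℝ)
    (hH : ∀ z, H z = (e z + g z) / (4 * lam z))
    (hKe : ∀ z, Ke z = (e z * g z - f z ^ 2) / (4 * lam z ^ 2))
    (c : ℝ) (hc : 0 < c) (hKec : ∀ z ∈ U, Ke z = c)
    (hHpos : ∀ z ∈ U, 0 < H z)
    (Q : ℂ → ℂ)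
    (hQ : ∀ z, Q z = (((e z - g z) / 4 : ℝ) : ℂ) - Complex.I * ((f z / 2 : ℝ) : ℂ)) :
    (∀ z ∈ U, Q z = 0) ∨
      (∀ z₀ ∈ U, Q z₀ = 0 → ∃ V ∈ nhds z₀, ∀ z ∈ V, z ≠ z₀ → Q z ≠ 0) := by
  have hQe : Q = fun z => (((e z - g z) / 4 : ℝ) : ℂ) - Complex.I * ((f z / 2 : ℝ) : ℂ) :=
    funext hQ
  have hnU : ∀ z ∈ U, U ∈ 𝓝 z := fun z hz => hUopen.mem_nhds hz
  have cl : ∀ z ∈ U, ContDiffAt ℝ 1 lam z := fun z hz => hlam.contDiffAt (hnU z hz)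
  have ce : ∀ z ∈ U, ContDiffAt ℝ 1 e z := fun z hz => he.contDiffAt (hnU z hz)
  have cf : ∀ z ∈ U, ContDiffAt ℝ 1 f z := fun z hz => hf.contDiffAt (hnU z hz)
  have cg : ∀ z ∈ U, ContDiffAt ℝ 1 g z := fun z hz => hg.contDiffAt (hnU z hz)
  have cQ : ∀ z ∈ U, ContDiffAt ℝ 1 Q z := by
    intro z hz
    rw [hQe]
    have h1 : ContDiffAt ℝ 1 (fun z => (((e z - g z) / 4 : ℝ) : ℂ)) z :=
      Complex.ofRealCLM.contDiff.contDiffAt.comp z (((ce z hz).sub (cg z hz)).div_const 4)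
    have h2 : ContDiffAt ℝ 1 (fun z => ((f z / 2 : ℝ) : ℂ)) z :=
      Complex.ofRealCLM.contDiff.contDiffAt.comp z ((cf z hz).div_const 2)
    exact h1.sub (contDiffAt_const.mul h2)
  have spos : ∀ z ∈ U, 0 < e z + g z := by
    intro z hz
    have h1 := hHpos z hz
    rw [hH] at h1
    have h2 := hpos z hz
    rcases div_pos_iff.1 h1 with h | h
    · exact h.1
    · linarith [h.2]
  have hK : ∀ z ∈ U, e z * g z - f z ^ 2 = 4 * c * lam z ^ 2 := by
    intro z hz
    have h1 := hKec z hz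
    have h2 := hpos z hz
    rw [hKe, div_eq_iff (by positivity)] at h1
    linarith
  have hnQ : ∀ z, (e z - g z) ^ 2 + 4 * f z ^ 2 = 16 * ‖Q z‖ ^ 2 := by
    intro z
    rw [Complex.sq_norm, Complex.normSq_apply, hQ]
    simp
    ring
  -- derivative of the curvature identity
  have hKd : ∀ z ∈ U, ∀ w : ℂ, fderiv ℝ e z w * g z + e z * fderiv ℝ g z w
      - 2 * f z * fderiv ℝ f z w = 8 * c * lam z * fderiv ℝ lam z w := by
    intro z hz w
    have de := ((ce z hz).differentiableAt one_ne_zero).hasFDerivAt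
    have dg := ((cg z hz).differentiableAt one_ne_zero).hasFDerivAt
    have df := ((cf z hz).differentiableAt one_ne_zero).hasFDerivAt
    have dl := ((cl z hz).differentiableAt one_ne_zero).hasFDerivAt
    have h1 := (de.mul dg).sub (df.mul df)
    have h2 := (dl.mul dl).const_mul (4 * c)
    have h3 : (fun z => 4 * c * (lam z * lam z)) =ᶠ[𝓝 z] (fun z => e z * g z - f z * f z) := by
      filter_upwards [hnU z hz] with y hy
      have := hK y hy
      linarith
    have h4 := (h1.congr_of_eventuallyEq h3).unique h2
    have h5 := congrArg (fun T : ℂ →L[ℝ] ℝ => T w) h4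
    simp at h5
    linarith
  let m : ℂ → ℂ → ℝ := fun w z => (4 * |fderiv ℝ e z w - fderiv ℝ g z w| + 8 * |fderiv ℝ f z w|
    + 16 * ‖Q z‖ * |fderiv ℝ lam z w| / lam z) / (e z + g z)
  have hm : ∀ z ∈ U, ∀ w, |fderiv ℝ e z w + fderiv ℝ g z w
      - (e z + g z) * fderiv ℝ lam z w / lam z| ≤ ‖Q z‖ * m w z := by
    intro z hz w
    have h1 := hK z hz
    have h2 := hKd z hz w
    refine bound_alg (c := c) (a := e z - g z) (f := f z) (spos z hz) (hpos z hz) ?_ ?_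
      (norm_nonneg _) (hnQ z)
    · linear_combination 4 * h1
    · linear_combination 2 * h2
  have hdb : ∀ z ∈ U, ‖dbarC Q z‖ ≤ (m 1 z + m Complex.I z) * ‖Q z‖ := by
    intro z hz
    have de := ((ce z hz).differentiableAt one_ne_zero).hasFDerivAt
    have dg := ((cg z hz).differentiableAt one_ne_zero).hasFDerivAt
    have df := ((cf z hz).differentiableAt one_ne_zero).hasFDerivAt
    have dQ : ∀ w, fderiv ℝ Q z w = (((fderiv ℝ e z w - fderiv ℝ g z w) / 4 : ℝ) : ℂ)
        - Complex.I * ((fderiv ℝ f z w / 2 : ℝ) : ℂ) := by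
      intro w
      have h1 := Complex.ofRealCLM.hasFDerivAt.comp z ((de.sub dg).const_mul (1/4))
      have h2 := (Complex.ofRealCLM.hasFDerivAt.comp z (df.const_mul (1/2))).const_mul Complex.I
      have h3 := h1.sub h2
      have h4 : HasFDerivAt Q _ z := h3.congr_of_eventuallyEq (Eventually.of_forall fun y => by
        rw [hQ]; simp; ring)
      rw [h4.fderiv]
      simp
      ring
    have c1 := hcod1 z hz
    have c2 := hcod2 z hz
    simp only [pu, pv] at c1 c2
    have hl := hpos z hz
    set A := fderiv ℝ e z 1 + fderiv ℝ g z 1 - (e z + g z) * fderiv ℝ lam z 1 / lam z with hA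
    set B := fderiv ℝ e z Complex.I + fderiv ℝ g z Complex.I
      - (e z + g z) * fderiv ℝ lam z Complex.I / lam z with hB
    have c1' : fderiv ℝ f z 1 = fderiv ℝ e z Complex.I
        - ((e z + g z) * fderiv ℝ lam z Complex.I / lam z) / 2 := by
      rw [show (e z + g z) * fderiv ℝ lam z Complex.I / (2 * lam z)
        = ((e z + g z) * fderiv ℝ lam z Complex.I / lam z) / 2 by field_simp] at c1
      linarith
    have c2' : fderiv ℝ f z Complex.I = fderiv ℝ g z 1
        - ((e z + g z) * fderiv ℝ lam z 1 / lam z) / 2 := by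
      rw [show (e z + g z) * fderiv ℝ lam z 1 / (2 * lam z)
        = ((e z + g z) * fderiv ℝ lam z 1 / lam z) / 2 by field_simp] at c2
      linarith
    have hval : dbarC Q z = ((A / 8 : ℝ) : ℂ) - Complex.I * ((B / 8 : ℝ) : ℂ) := by
      rw [dbarC, dQ, dQ, c1', c2', hA, hB]
      push_cast
      linear_combination (-(1/4:ℂ)) * ((fderiv ℝ g z 1 : ℂ)
        - (((e z:ℂ) + g z) * (fderiv ℝ lam z 1 : ℂ) / lam z) / 2) * Complex.I_sq
    rw [hval]
    have b1 := hm z hz 1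
    have b2 := hm z hz Complex.I
    rw [← hA] at b1
    rw [← hB] at b2
    calc _ ≤ ‖((A / 8 : ℝ) : ℂ)‖ + ‖Complex.I * ((B / 8 : ℝ) : ℂ)‖ := norm_sub_le _ _
      _ = |A| / 8 + |B| / 8 := by
        rw [norm_mul, Complex.norm_I, one_mul, Complex.norm_real, Complex.norm_real,
          Real.norm_eq_abs, Real.norm_eq_abs, abs_div, abs_div]
        norm_num
      _ ≤ _ := by linarith [abs_nonneg A, abs_nonneg B]
  have hmc : ∀ w, ∀ z ∈ U, ContinuousAt (m w) z := by
    intro w z hz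
    have fe := ((ce z hz).fderiv_right (m := 0) le_rfl).continuousAt.clm_apply (continuousAt_const (y := w))
    have fg := ((cg z hz).fderiv_right (m := 0) le_rfl).continuousAt.clm_apply (continuousAt_const (y := w))
    have ff := ((cf z hz).fderiv_right (m := 0) le_rfl).continuousAt.clm_apply (continuousAt_const (y := w))
    have fl := ((cl z hz).fderiv_right (m := 0) le_rfl).continuousAt.clm_apply (continuousAt_const (y := w))
    have xe := (ce z hz).continuousAt
    have xg := (cg z hz).continuousAt
    have xl := (cl z hz).continuousAt
    have xQ := (cQ z hz).continuousAt
    refine ContinuousAt.div (((continuousAt_const.mul (fe.sub fg).abs).add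
      (continuousAt_const.mul ff.abs)).add
      (((continuousAt_const.mul xQ.norm).mul fl.abs).div xl (hpos z hz).ne')) (xe.add xg)
      (spos z hz).ne'
  have hloc : ∀ z ∈ U, (∃ᶠ y in 𝓝[≠] z, Q y = 0) → ∀ᶠ y in 𝓝 z, Q y = 0 := by
    intro z hz hfr
    have hc : ContinuousAt (fun y => m 1 y + m Complex.I y) z := (hmc 1 z hz).add (hmc _ z hz)
    have hev := hc.eventually_lt (continuousAt_const (y := |m 1 z + m Complex.I z| + 1))
      (by linarith [le_abs_self (m 1 z + m Complex.I z)])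
    obtain ⟨r, hr, hsub⟩ := Metric.mem_nhds_iff.1 (inter_mem hev (hnU z hz))
    refine local_ucp (M := |m 1 z + m Complex.I z| + 1) hr (by positivity)
      (fun y hy => cQ y (hsub hy).2) (fun y hy => ?_) hfr
    have h1 : m 1 y + m Complex.I y < |m 1 z + m Complex.I z| + 1 := (hsub hy).1
    exact (hdb y (hsub hy).2).trans (mul_le_mul_of_nonneg_right h1.le (norm_nonneg _))
  by_cases hiso : ∀ z₀ ∈ U, Q z₀ = 0 → ∃ V ∈ nhds z₀, ∀ z ∈ V, z ≠ z₀ → Q z ≠ 0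
  · exact Or.inr hiso
  left
  push Not at hiso
  obtain ⟨z₀, hz₀, hQ0, hV⟩ := hiso
  set Z : Set ℂ := {z | ∀ᶠ y in 𝓝 z, Q y = 0} with hZ
  have hZo : IsOpen Z := isOpen_setOfPred_eventually_nhds
  have hz₀Z : z₀ ∈ Z := by
    refine hloc z₀ hz₀ ?_
    intro hcon
    rw [eventually_nhdsWithin_iff] at hcon
    obtain ⟨z, hz1, hz2, hz3⟩ := hV _ hcon
    exact hz1 hz2 hz3
  have hsub : U ⊆ Z := by
    refine hUconn.isPreconnected.subset_of_closure_inter_subset hZo ⟨z₀, hz₀, hz₀Z⟩ ?_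
    rintro z ⟨hzc, hzU⟩
    by_contra hzn
    apply hzn
    refine hloc z hzU ?_
    intro hcon
    rw [eventually_nhdsWithin_iff] at hcon
    obtain ⟨y, hy1, hy2⟩ := mem_closure_iff_nhds.1 hzc _ hcon
    have hy0 : Q y = 0 := Filter.Eventually.self_of_nhds (p := fun y => Q y = 0) hy2
    refine hy1 ?_ hy0
    rintro rfl
    exact hzn hy2
  intro z hz
  exact Filter.Eventually.self_of_nhds (p := fun y => Q y = 0) (hsub hz)
end

section
/- If the Codazzi equations ∂_v e − ∂_u f = (e+g)(∂_v λ)/(2λ) and ∂_v f − ∂_u g = −(e+g)(∂_u λ)/(2λ) hold on U and the mean curvature H is constant on U, then ∂_{z̄} Q = 0 on U; that is, Q is a holomorphic function on U. -/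
/-- The Wirtinger derivative `∂_z̄ Φ = ½(∂_u Φ + i ∂_v Φ)`. -/
noncomputable def dzbar (Φ : ℂ → ℂ) (z : ℂ) : ℂ :=
  (1 / 2 : ℂ) * (fderiv ℝ Φ z 1 + Complex.I * fderiv ℝ Φ z Complex.I)

/-- If the Codazzi equations hold for a fundamental pair written in a conformal
parameter and the mean curvature `H = (e+g)/(4λ)` is constant on `U`, then
`∂_z̄ Q = 0` on `U`, i.e. `Q` is holomorphic on `U`. -/
theorem codazzi_constant_H_Q_holomorphic
    (U : Set ℂ) (hUopen : IsOpen U)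
    (lam e f g : ℂ → ℝ)
    (hlam : ContDiffOn ℝ 1 lam U) (he : ContDiffOn ℝ 1 e U)
    (hf : ContDiffOn ℝ 1 f U) (hg : ContDiffOn ℝ 1 g U)
    (hpos : ∀ z ∈ U, 0 < lam z)
    (hcod1 : ∀ z ∈ U, pv e z - pu f z = (e z + g z) * pv lam z / (2 * lam z))
    (hcod2 : ∀ z ∈ U, pv f z - pu g z = -((e z + g z) * pu lam z / (2 * lam z)))
    (H : ℂ → ℝ) (hH : ∀ z, H z = (e z + g z) / (4 * lam z))
    (hconst : ∃ c : ℝ, ∀ z ∈ U, H z = c)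
    (Q : ℂ → ℂ)
    (hQ : ∀ z, Q z = (((e z - g z) / 4 : ℝ) : ℂ) - Complex.I * ((f z / 2 : ℝ) : ℂ)) :
    (∀ z ∈ U, dzbar Q z = 0) ∧ DifferentiableOn ℂ Q U := by
  obtain ⟨c, hc⟩ := hconst
  have key : ∀ z ∈ U, DifferentiableAt ℝ Q z ∧
      fderiv ℝ Q z 1 + Complex.I * fderiv ℝ Q z Complex.I = 0 := by
    intro z hz
    have hn : U ∈ nhds z := hUopen.mem_nhds hz
    have dl := ((hlam.contDiffAt hn).differentiableAt one_ne_zero).hasFDerivAt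
    have de := ((he.contDiffAt hn).differentiableAt one_ne_zero).hasFDerivAt
    have df := ((hf.contDiffAt hn).differentiableAt one_ne_zero).hasFDerivAt
    have dg := ((hg.contDiffAt hn).differentiableAt one_ne_zero).hasFDerivAt
    have hsum : ∀ w ∈ U, e w + g w = 4 * c * lam w := by
      intro w hw
      have h1 := hc w hw
      have h2 := hpos w hw
      rw [hH, div_eq_iff (by positivity)] at h1
      linarith
    have hev : (fun w => e w + g w) =ᶠ[nhds z] fun w => 4 * c * lam w := by
      filter_upwards [hn] with w hw using hsum w hw
    have hD := ((de.add dg).congr_of_eventuallyEq hev.symm).unique (dl.const_mul (4 * c))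
    have hDu := congrArg (fun L => L 1) hD
    have hDv := congrArg (fun L => L Complex.I) hD
    simp only [add_apply, smul_apply, smul_eq_mul] at hDu hDv
    have c1 := hcod1 z hz
    have c2 := hcod2 z hz
    have hp := hpos z hz
    rw [hsum z hz] at c1 c2
    have c1' : pv e z - pu f z = 2 * c * pv lam z := by rw [c1]; field_simp; ring
    have c2' : pv f z - pu g z = -(2 * c * pu lam z) := by rw [c2]; field_simp; ring
    simp only [pu, pv] at c1' c2'
    have dQ := ((Complex.ofRealCLM.hasFDerivAt.comp z ((de.sub dg).const_mul (1/4))).sub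
      ((Complex.ofRealCLM.hasFDerivAt.comp z (df.const_mul (1/2))).const_mul Complex.I))
    have dQ' := dQ.congr_of_eventuallyEq (f₁ := Q) (by
      refine Filter.Eventually.of_forall fun w => ?_
      simp [hQ]
      ring)
    refine ⟨dQ'.differentiableAt, ?_⟩
    rw [dQ'.fderiv]
    apply Complex.ext
    · simp
      linarith
    · simp
      linarith
  refine ⟨fun z hz => by rw [dzbar, (key z hz).2, mul_zero], fun z hz => ?_⟩
  obtain ⟨h1, h2⟩ := key z hz
  refine DifferentiableAt.differentiableWithinAt ?_
  rw [differentiableAt_complex_iff_differentiableAt_real]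
  refine ⟨h1, ?_⟩
  rw [smul_eq_mul]
  linear_combination (-Complex.I) * h2 + fderiv ℝ Q z Complex.I * Complex.I_sq
end
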